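/- arXiv:1407.0967 — 4 statements merged into one kernel-verified Lean document; each statement's English description precedes it below -/
import Mathlib

section
/- Let p > 3 be a prime. Then ∑_{k=1}^{p-1} g_k ≡ p²·∑_{k=1}^{p-1} g_k·H_k^{(2)} + (7/6)·p³·B_{p-3} (mod p⁴). -/
/-- `g n = ∑_{k=0}^n (n choose k)² (2k choose k)`. -/
def g (n : ℕ) : ℤ :=
  ∑ k ∈ Finset.range (n + 1), (n.choose k : ℤ) ^ 2 * ((2 * k).choose k : ℤ)

/-- Harmonic number of order 2: `H_k^{(2)} = ∑_{j=1}^k 1/j²`. -/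
def H2 (k : ℕ) : ℚ := ∑ j ∈ Finset.range k, 1 / ((j : ℚ) + 1) ^ 2

/-- For rationals, `a ≡ b (mod p^m)` means the p-adic valuation of `a - b` is at least `m`. -/
def ratCongr (p m : ℕ) (a b : ℚ) : Prop :=
  a = b ∨ (m : ℤ) ≤ padicValRat p (a - b)

open Finset

section Binomial

lemma sum_neg_one_pow_choose_succ_mul (M : ℕ) (f : ℕ → ℚ) :
    ∑ i ∈ range (M + 2), (-1) ^ i * ((M + 1).choose i : ℚ) * f i =
      ∑ i ∈ range (M + 1), (-1) ^ i * (M.choose i : ℚ) * (f i - f (i + 1)) := by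
  have h : ∑ i ∈ range (M + 1), (-1) ^ i * (M.choose i : ℚ) * f i =
      ∑ i ∈ range (M + 1), (-1) ^ (i + 1) * (M.choose (i + 1) : ℚ) * f (i + 1) + f 0 := by
    have := sum_range_succ (fun i => (-1) ^ i * (M.choose i : ℚ) * f i) (M + 1)
    rw [sum_range_succ'] at this
    simp only [Nat.choose_succ_self] at this
    simpa using this.symm
  simp only [mul_sub, sum_sub_distrib]
  rw [h, sum_range_succ']
  simp only [Nat.choose_succ_succ, pow_zero, Nat.choose_zero_right, Nat.cast_one, one_mul]
  rw [add_sub_right_comm, ← sum_sub_distrib]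
  congr 1
  refine sum_congr rfl fun i _ => ?_
  push_cast
  ring

lemma sum_neg_one_pow_choose_mul_choose (M a b : ℕ) :
    ∑ i ∈ range (M + 1), (-1) ^ i * (M.choose i : ℚ) * ((b + i).choose (a + M) : ℚ) =
      (-1) ^ M * (b.choose a : ℚ) := by
  induction M generalizing a with
  | zero => simp
  | succ M ih =>
    rw [sum_neg_one_pow_choose_succ_mul, pow_succ, mul_right_comm, ← ih a, sum_mul]
    refine sum_congr rfl fun i _ => ?_
    rw [← add_assoc b i 1, ← add_assoc a M 1, Nat.choose_succ_succ]
    push_cast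
    ring

lemma sum_neg_one_pow_choose_mul_choose_of_lt {M a : ℕ} (b : ℕ) (h : a < M) :
    ∑ i ∈ range (M + 1), (-1) ^ i * (M.choose i : ℚ) * ((b + i).choose a : ℚ) = 0 := by
  induction M generalizing a with
  | zero => simp at h
  | succ M ih =>
    rw [sum_neg_one_pow_choose_succ_mul]
    cases a with
    | zero => simp
    | succ a =>
      rw [← neg_eq_zero, ← sum_neg_distrib, ← ih (Nat.lt_of_succ_lt_succ h)]
      refine sum_congr rfl fun i _ => ?_
      rw [← add_assoc b i 1, Nat.choose_succ_succ]
      push_cast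
      ring

lemma cast_choose_mul_succ {n k : ℕ} (h : k ≤ n + 1) :
    (n.choose k : ℚ) * (n + 1) = (n + 1).choose k * (n + 1 - k) := by
  have := Nat.choose_mul_succ_eq n k
  rw [← Nat.cast_inj (R := ℚ)] at this
  push_cast [Nat.cast_sub h] at this
  exact this

lemma cast_choose_add_mul_succ (n j : ℕ) :
    ((n + j).choose j : ℚ) * (n + j + 1) = (n + 1 + j).choose j * (n + 1) := by
  have := cast_choose_mul_succ (n := n + j) (k := j) (by lia)
  rw [add_right_comm n 1 j]
  push_cast at this
  linear_combination this

lemma sum_choose_mul_choose_add_div (n : ℕ) :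
    ∑ j ∈ range (n + 1), (-1) ^ j * ((n.choose j : ℚ) * (n + j).choose j) / (2 * j + 1) =
      1 / (2 * n + 1) := by
  induction n with
  | zero => simp
  | succ n ih =>
    have h0 := sum_neg_one_pow_choose_mul_choose_of_lt n (Nat.lt_succ_self n)
    have hz : ∑ j ∈ range (n + 2),
        (-1) ^ j * ((n.choose j : ℚ) * (n + j).choose j) / (2 * j + 1) = 1 / (2 * n + 1) := by
      rw [sum_range_succ, ih, Nat.choose_succ_self]
      simp
    have hn : (2 * n + 1 : ℚ) ≠ 0 := by positivity
    have hn' : (2 * (n + 1 : ℕ) + 1 : ℚ) ≠ 0 := by positivity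
    rw [eq_div_iff hn']
    rw [eq_div_iff hn] at hz
    refine Eq.trans ?_ hz
    rw [← sub_eq_zero, sum_mul, sum_mul, ← sum_sub_distrib, ← mul_zero (2 : ℚ), ← h0, mul_sum]
    refine sum_congr rfl fun j hj => ?_
    have hj : j ≤ n + 1 := Nat.lt_succ_iff.mp (mem_range.mp hj)
    have h1 := cast_choose_mul_succ hj
    have h2 := cast_choose_add_mul_succ n j
    rw [Nat.choose_symm_add]
    have hn1 : (n + 1 : ℚ) ≠ 0 := by positivity
    have hj1 : (2 * j + 1 : ℚ) ≠ 0 := by positivity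
    rw [div_mul_eq_mul_div, div_mul_eq_mul_div, ← sub_div, div_eq_iff hj1]
    apply mul_left_cancel₀ hn1
    push_cast
    linear_combination (-1) ^ j * (-(2 * n + 3) * ((n + 1).choose j : ℚ) * h2 -
      (2 * n + 1) * ((n + j).choose j : ℚ) * h1)

lemma sum_choose_mul_choose_succ_add_div (m : ℕ) :
    ∑ j ∈ range (2 * m + 1), (-1) ^ j * (((2 * m).choose j : ℚ) * (2 * m + 1 + j).choose j) *
      ((2 * m + 1) / (2 * j + 1)) = 1 := by
  let y : ℕ → ℚ := fun N => ∑ j ∈ range (N + 1),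
    (-1) ^ j * ((N.choose j : ℚ) * (N + 1 + j).choose j) * ((N + 1) / (2 * j + 1))
  have step (N : ℕ) : y N + y (N + 1) = 1 := by
    have hy : y N = ∑ j ∈ range (N + 2),
        (-1) ^ j * ((N.choose j : ℚ) * (N + 1 + j).choose j) * ((N + 1) / (2 * j + 1)) := by
      rw [sum_range_succ, Nat.choose_succ_self]
      simp [y]
    have h := sum_choose_mul_choose_add_div (N + 1)
    have hN : (2 * (N + 1 : ℕ) + 1 : ℚ) ≠ 0 := by positivity
    rw [eq_div_iff hN, sum_mul] at h
    refine Eq.trans ?_ h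
    rw [hy, ← sum_add_distrib]
    refine sum_congr rfl fun j hj => ?_
    have h1 := cast_choose_mul_succ (Nat.lt_succ_iff.mp (mem_range.mp hj))
    have h2 := cast_choose_add_mul_succ (N + 1) j
    have hj1 : (2 * j + 1 : ℚ) ≠ 0 := by positivity
    field_simp
    push_cast at h2 ⊢
    linear_combination ((N + 1 + j).choose j : ℚ) * h1 - ((N + 1).choose j : ℚ) * h2
  have key : y (2 * m) = 1 := by
    induction m with
    | zero => simp [y]
    | succ m ih =>
      have h1 := step (2 * m)
      have h2 := step (2 * m + 1)
      rw [show 2 * (m + 1) = 2 * m + 1 + 1 by ring]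
      linarith
  simpa [y] using key

lemma sum_choose_mul_choose_mul_choose_sq {N j : ℕ} (hN : Even N) (hj : j ≤ N) :
    ∑ k ∈ range (N + 1),
        (-1) ^ k * ((N.choose k : ℚ) * (N + 1 + k).choose k) * (k.choose j : ℚ) ^ 2 =
      (N.choose j : ℚ) * ((N + 1 + j).choose j : ℚ) * ((N + 1 + j).choose (2 * j + 1) : ℚ) := by
  obtain ⟨M, rfl⟩ := Nat.exists_eq_add_of_le hj
  have hz : ∑ k ∈ range j, (-1) ^ k * (((j + M).choose k : ℚ) * (j + M + 1 + k).choose k) *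
      (k.choose j : ℚ) ^ 2 = 0 :=
    sum_eq_zero fun k hk => by rw [Nat.choose_eq_zero_of_lt (mem_range.mp hk)]; simp
  have hs : (-1 : ℚ) ^ j * (-1) ^ M = 1 := by rw [← pow_add, hN.neg_one_pow]
  have h := sum_neg_one_pow_choose_mul_choose M (2 * j + 1) (2 * j + 1 + M)
  rw [show range (j + M + 1) = range (j + (M + 1)) from rfl, sum_range_add, hz, zero_add,
    show j + M + 1 + j = 2 * j + 1 + M by ring]
  calc _ = ∑ i ∈ range (M + 1),
        (-1) ^ j * (((j + M).choose j : ℚ) * ((2 * j + 1 + M).choose j : ℚ)) *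
        ((-1) ^ i * (M.choose i : ℚ) * ((2 * j + 1 + M + i).choose (2 * j + 1 + M) : ℚ)) := by
        refine sum_congr rfl fun i hi => ?_
        have hi : i ≤ M := Nat.lt_succ_iff.mp (mem_range.mp hi)
        have h1 : (j + M).choose (j + i) * (j + i).choose j = (j + M).choose j * M.choose i := by
          simpa using Nat.choose_mul (n := j + M) (k := j + i) (s := j) (by lia)
        have h2 : (2 * j + 1 + M + i).choose (j + i) * (j + i).choose j =
            (2 * j + 1 + M + i).choose (2 * j + 1 + M) * (2 * j + 1 + M).choose j := by
          have := Nat.choose_mul (n := 2 * j + 1 + M + i) (k := j + i) (s := i) (by lia)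
          rw [Nat.choose_symm_add, this]
          simp [Nat.choose_symm_add]
        rw [show j + M + 1 + (j + i) = 2 * j + 1 + M + i by ring]
        rw [← Nat.cast_inj (R := ℚ)] at h1 h2
        push_cast at h1 h2
        rw [pow_add]
        linear_combination (-1) ^ j * (-1) ^ i *
          (((2 * j + 1 + M + i).choose (j + i) : ℚ) * (j + i).choose j * h1 +
          ((j + M).choose j : ℚ) * M.choose i * h2)
    _ = _ := by
        rw [← mul_sum, h]
        linear_combination ((j + M).choose j : ℚ) * ((2 * j + 1 + M).choose j : ℚ) *
          ((2 * j + 1 + M).choose (2 * j + 1) : ℚ) * hs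

lemma choose_two_mul_succ_mul_centralBinom (N j : ℕ) :
    (N + 1 + j).choose (2 * j + 1) * (2 * j).choose j * (2 * j + 1) =
      (N + 1) * (N.choose j * (N + 1 + j).choose j) := by
  rcases lt_or_ge N j with hj | hj
  · rw [Nat.choose_eq_zero_of_lt hj, Nat.choose_eq_zero_of_lt (by lia)]
    simp
  have h1 := Nat.choose_mul_succ_eq (2 * j) j
  have h2 := Nat.choose_mul (n := N + 1 + j) (k := 2 * j + 1) (s := j) (by lia)
  have h3 := Nat.add_one_mul_choose_eq N j
  rw [show 2 * j + 1 - j = j + 1 by lia] at h1 h2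
  rw [Nat.add_sub_cancel] at h2
  rw [mul_assoc, h1, ← mul_assoc, h2, mul_assoc, ← h3]
  ring

lemma sum_choose_mul_choose_mul_g {N : ℕ} (hN : Even N) :
    ∑ k ∈ range (N + 1), (-1) ^ k * ((N.choose k : ℚ) * (N + 1 + k).choose k) * g k =
      ∑ j ∈ range (N + 1),
        (N + 1) / (2 * j + 1) * ((N.choose j : ℚ) * (N + 1 + j).choose j) ^ 2 := by
  have hg (k : ℕ) (hk : k ∈ range (N + 1)) : (g k : ℚ) =
      ∑ j ∈ range (N + 1), (k.choose j : ℚ) ^ 2 * (2 * j).choose j := by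
    rw [g]
    push_cast
    refine sum_subset (range_subset_range.mpr (by simpa using hk)) fun j _ hj => ?_
    rw [Nat.choose_eq_zero_of_lt (by simpa using hj)]
    simp
  rw [sum_congr rfl fun k hk => by rw [hg k hk]]
  simp only [mul_sum]
  rw [sum_comm]
  refine sum_congr rfl fun j hj => ?_
  have h1 := sum_choose_mul_choose_mul_choose_sq hN (Nat.lt_succ_iff.mp (mem_range.mp hj))
  have h2 := choose_two_mul_succ_mul_centralBinom N j
  rw [← Nat.cast_inj (R := ℚ)] at h2
  push_cast at h2
  have hj1 : (2 * j + 1 : ℚ) ≠ 0 := by positivity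
  simp only [← mul_assoc] at h1 ⊢
  rw [← sum_mul, h1]
  field_simp
  linear_combination ((N.choose j : ℚ) * (N + 1 + j).choose j) * h2

end Binomial

section Reflection

lemma sum_range_two_mul_reflect (u : ℚ → ℚ) (h : ℕ) :
    ∑ k ∈ range (2 * h), u (k + 1) =
      ∑ k ∈ range h, (u (k + 1) + u (2 * h + 1 - (k + 1))) := by
  rw [two_mul, sum_range_add, sum_add_distrib,
    ← sum_range_reflect (fun i => u ((h + i : ℕ) + 1))]
  congr 1
  refine sum_congr rfl fun k hk => ?_
  have hk : k + 1 ≤ h := mem_range.mp hk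
  rw [show h - 1 - k = h - (k + 1) by lia]
  push_cast [Nat.cast_sub hk]
  congr 1
  ring

lemma sum_range_two_mul_reflect_even (u : ℚ → ℚ) (h : ℕ) :
    ∑ k ∈ range (2 * h), u (k + 1) =
      ∑ k ∈ range h, (u (2 * (k + 1)) + u (2 * h + 1 - 2 * (k + 1))) := by
  have hsplit : ∑ k ∈ range (2 * h), u (k + 1) =
      ∑ k ∈ range h, u (2 * (k + 1)) + ∑ k ∈ range h, u ((2 * k : ℕ) + 1) := by
    induction h with
    | zero => simp
    | succ h ih =>
      rw [show 2 * (h + 1) = 2 * h + 1 + 1 by ring, sum_range_succ, sum_range_succ, ih,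
        sum_range_succ, sum_range_succ]
      push_cast
      ring_nf
  rw [hsplit, sum_add_distrib, ← sum_range_reflect (fun i => u ((2 * i : ℕ) + 1))]
  congr 1
  refine sum_congr rfl fun k hk => ?_
  have hk : k + 1 ≤ h := mem_range.mp hk
  rw [show h - 1 - k = h - (k + 1) by lia]
  push_cast [Nat.cast_sub hk]
  congr 1
  ring

lemma sum_range_two_mul_add_one_div_odd (c : ℚ) (h : ℕ) :
    ∑ j ∈ range (2 * h + 1), c / (2 * j + 1) = c / (2 * h + 1) +
      ∑ k ∈ range h, (c / (2 * h + 1 - 2 * (k + 1)) + c / (2 * h + 1 + 2 * (k + 1))) := by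
  rw [show 2 * h + 1 = h + 1 + h by ring, sum_range_add, sum_range_succ, sum_add_distrib,
    ← sum_range_reflect]
  have h1 : ∑ j ∈ range h, c / (2 * ((h - 1 - j : ℕ) : ℚ) + 1) =
      ∑ k ∈ range h, c / (2 * h + 1 - 2 * (k + 1)) := by
    refine sum_congr rfl fun k hk => ?_
    have hk : k + 1 ≤ h := mem_range.mp hk
    rw [show h - 1 - k = h - (k + 1) by lia]
    push_cast [Nat.cast_sub hk]
    congr 1
    ring
  have h2 : ∑ j ∈ range h, c / (2 * ((h + 1 + j : ℕ) : ℚ) + 1) =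
      ∑ k ∈ range h, c / (2 * h + 1 + 2 * (k + 1)) := by
    refine sum_congr rfl fun k _ => ?_
    push_cast
    congr 1
    ring
  rw [h1, h2]
  ring

end Reflection

/-- The subring of `p`-integral rational numbers. -/
def pIntegers (p : ℕ) [Fact p.Prime] : Subring ℚ where
  carrier := {x | padicNorm p x ≤ 1}
  mul_mem' {a b} ha hb := by
    simp only [Set.mem_ofPred_eq, padicNorm.mul] at *
    exact mul_le_one₀ ha (padicNorm.nonneg b) hb
  one_mem' := by simp
  add_mem' ha hb := padicNorm.nonarchimedean.trans (max_le ha hb)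
  zero_mem' := by simp
  neg_mem' := by simp

namespace pIntegers

variable {p : ℕ} [Fact p.Prime]

lemma inv_natCast_mem {n : ℕ} (h : ¬p ∣ n) : (n : ℚ)⁻¹ ∈ pIntegers p := by
  change padicNorm p _ ≤ 1
  rw [inv_eq_one_div, padicNorm.div, (padicNorm.nat_eq_one_iff n).mpr h]
  simp

lemma inv_natCast_mem_of_lt {n : ℕ} (h0 : 0 < n) (h : n < p) : (n : ℚ)⁻¹ ∈ pIntegers p :=
  inv_natCast_mem (Nat.not_dvd_of_pos_of_lt h0 h)

lemma ratCongr_of_sub_eq {m : ℕ} {a b r : ℚ} (hr : r ∈ pIntegers p)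
    (h : a - b = (p : ℚ) ^ m * r) : ratCongr p m a b := by
  have hp0 : (p : ℚ) ≠ 0 := Nat.cast_ne_zero.mpr (Fact.out : p.Prime).ne_zero
  by_cases hr0 : r = 0
  · left
    rw [hr0, mul_zero] at h
    exact sub_eq_zero.mp h
  · right
    have hr' : padicNorm p r ≤ 1 := hr
    rw [padicNorm.eq_zpow_of_nonzero hr0, zpow_le_one_iff_right₀
      (by exact_mod_cast (Fact.out : p.Prime).one_lt)] at hr'
    rw [h, padicValRat.mul (pow_ne_zero _ hp0) hr0, padicValRat.pow,
      padicValRat.self (Fact.out : p.Prime).one_lt]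
    linarith

lemma exists_sum_eq_add_mul {ι : Type*} {s : Finset ι} {u v : ι → ℚ} {c : ℚ}
    (h : ∀ i ∈ s, ∃ r ∈ pIntegers p, u i = v i + c * r) :
    ∃ r ∈ pIntegers p, ∑ i ∈ s, u i = ∑ i ∈ s, v i + c * r := by
  choose! r hr hu using h
  exact ⟨∑ i ∈ s, r i, sum_mem hr, by rw [sum_congr rfl hu, sum_add_distrib, mul_sum]⟩

lemma bernoulli_mem {n : ℕ} (hn : n + 1 < p) : bernoulli n ∈ pIntegers p := by
  induction n using Nat.strong_induction_on with
  | _ n ih =>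
    have h := sum_bernoulli (n + 1)
    rw [sum_range_succ, Nat.choose_succ_self_right] at h
    have hn1 : ((n + 1 : ℕ) : ℚ) ≠ 0 := Nat.cast_ne_zero.mpr n.succ_ne_zero
    rw [← eq_sub_iff_add_eq', mul_comm, ← eq_mul_inv_iff_mul_eq₀ hn1] at h
    rw [h]
    refine mul_mem (sub_mem ?_ (sum_mem fun k hk => ?_)) (inv_natCast_mem_of_lt n.succ_pos hn)
    · split_ifs
      exacts [one_mem _, zero_mem _]
    · have hk := mem_range.mp hk
      exact mul_mem (natCast_mem _ _) (ih k hk (by lia))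

/-- `∑ k^m` over `k < p` is `p * bernoulli m` modulo `p²`. -/
lemma exists_sum_pow_eq {m : ℕ} (hm0 : m ≠ 0) (hm : m + 1 < p) :
    ∃ r ∈ pIntegers p, ∑ k ∈ range (p - 1), ((k : ℚ) + 1) ^ m =
      p * bernoulli m + (p : ℚ) ^ 2 * r := by
  have hp : p - 1 + 1 = p := by lia
  have h := sum_range_pow p m
  have hm1 : ((m + 1 : ℕ) : ℚ) ≠ 0 := Nat.cast_ne_zero.mpr m.succ_ne_zero
  have hinv := inv_natCast_mem_of_lt (p := p) m.succ_pos hm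
  have hterm : ∀ i ∈ range m, ∃ r ∈ pIntegers p,
      bernoulli i * ((m + 1).choose i : ℚ) * (p : ℚ) ^ (m + 1 - i) / (m + 1) =
        0 + (p : ℚ) ^ 2 * r := by
    intro i hi
    have hi := mem_range.mp hi
    refine ⟨bernoulli i * ((m + 1).choose i : ℚ) * (p : ℚ) ^ (m - 1 - i) * ((m + 1 : ℕ) : ℚ)⁻¹,
      mul_mem (mul_mem (mul_mem (bernoulli_mem (by lia)) (natCast_mem _ _))
        (pow_mem (natCast_mem _ _) _)) hinv, ?_⟩
    rw [show m + 1 - i = 2 + (m - 1 - i) by lia, pow_add]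
    push_cast
    ring
  obtain ⟨r, hr, hsum⟩ := exists_sum_eq_add_mul hterm
  refine ⟨r, hr, ?_⟩
  conv_lhs at h => rw [← hp]
  rw [sum_range_succ', sum_range_succ, hsum, Nat.choose_succ_self_right] at h
  push_cast at h hm1
  rw [zero_pow hm0, add_zero] at h
  rw [h, show m + 1 - m = 1 by lia, sum_const_zero]
  field_simp
  ring

lemma exists_pow_card_sub_one_eq {x : ℕ} (h0 : 0 < x) (hx : x < p) :
    ∃ r ∈ pIntegers p, (x : ℚ) ^ (p - 1) = 1 + p * r := by
  have hp : p.Prime := Fact.out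
  have hcop : IsCoprime (x : ℤ) p :=
    Nat.isCoprime_iff_coprime.mpr (Nat.coprime_of_lt_prime h0.ne' hx hp).symm
  obtain ⟨z, hz⟩ := (Int.ModEq.pow_card_sub_one_eq_one hp hcop).symm.dvd
  refine ⟨z, intCast_mem _ z, ?_⟩
  rw [← sub_eq_iff_eq_add']
  exact_mod_cast hz

/-- A function with `u (p - x) ≡ u x + p * v x` modulo `p²` has its sum over the nonzero residues
determined modulo `p²` both by the first half of the residues and by the even ones. -/
lemma exists_sum_reflect {h : ℕ} (hp : p = 2 * h + 1) {u v : ℚ → ℚ}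
    (huv : ∀ x : ℕ, 0 < x → x < p →
      ∃ r ∈ pIntegers p, u (p - x) = u x + p * v x + (p : ℚ) ^ 2 * r) :
    (∃ r ∈ pIntegers p, ∑ k ∈ range (p - 1), u (k + 1) =
      ∑ k ∈ range h, (2 * u (k + 1) + p * v (k + 1)) + (p : ℚ) ^ 2 * r) ∧
    ∃ r ∈ pIntegers p, ∑ k ∈ range (p - 1), u (k + 1) =
      ∑ k ∈ range h, (2 * u (2 * (k + 1)) + p * v (2 * (k + 1))) + (p : ℚ) ^ 2 * r := by
  have hp1 : p - 1 = 2 * h := by lia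
  have hpc : (p : ℚ) = 2 * h + 1 := by rw [hp]; push_cast; rfl
  rw [hp1]
  constructor
  · rw [sum_range_two_mul_reflect]
    refine exists_sum_eq_add_mul fun k hk => ?_
    obtain ⟨r, hr, h⟩ := huv (k + 1) k.succ_pos (by have := mem_range.mp hk; lia)
    refine ⟨r, hr, ?_⟩
    push_cast at h
    rw [← hpc, h]
    ring
  · rw [sum_range_two_mul_reflect_even]
    refine exists_sum_eq_add_mul fun k hk => ?_
    obtain ⟨r, hr, h⟩ := huv (2 * (k + 1)) (by lia) (by have := mem_range.mp hk; lia)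
    refine ⟨r, hr, ?_⟩
    push_cast at h
    rw [← hpc, h]
    ring

/-- The half sum of inverse squares modulo `p²`, in terms of the half sum of inverse cubes. -/
lemma exists_half_sum_inv_sq_eq {h : ℕ} (hp : p = 2 * h + 1) (hp3 : 3 < p) :
    ∃ r ∈ pIntegers p, ∑ k ∈ range h, (((k : ℚ) + 1) ^ 2)⁻¹ =
      -(7 / 6) * p * ∑ k ∈ range h, (((k : ℚ) + 1) ^ 3)⁻¹ + (p : ℚ) ^ 2 * r := by
  have huv : ∀ x : ℕ, 0 < x → x < p → ∃ r ∈ pIntegers p,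
      (((p : ℚ) - x) ^ 2)⁻¹ = ((x : ℚ) ^ 2)⁻¹ + p * (2 * ((x : ℚ) ^ 3)⁻¹) + (p : ℚ) ^ 2 * r := by
    intro x h0 hx
    have hx0 : (x : ℚ) ≠ 0 := by positivity
    have hpx : (p : ℚ) - x ≠ 0 := sub_ne_zero.mpr (by exact_mod_cast hx.ne')
    have hi := inv_natCast_mem_of_lt h0 hx
    have hi' := inv_natCast_mem_of_lt (p := p) (n := p - x) (by lia) (by lia)
    rw [Nat.cast_sub hx.le] at hi'
    refine ⟨(3 * x - 2 * p) * (x : ℚ)⁻¹ ^ 3 * ((p : ℚ) - x)⁻¹ ^ 2,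
      mul_mem (mul_mem (sub_mem (mul_mem (ofNat_mem _ 3) (natCast_mem _ _))
        (mul_mem (ofNat_mem _ 2) (natCast_mem _ _))) (pow_mem hi _)) (pow_mem hi' _), ?_⟩
    field_simp
    ring
  obtain ⟨⟨r₁, hr₁, h₁⟩, r₂, hr₂, h₂⟩ :=
    exists_sum_reflect hp (u := fun x => (x ^ 2)⁻¹) (v := fun x => 2 * (x ^ 3)⁻¹) huv
  rw [h₁] at h₂
  simp only [mul_pow, mul_inv, sum_add_distrib, ← mul_sum] at h₂
  have hi3 := inv_natCast_mem_of_lt (p := p) (n := 3) (by lia) (by lia)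
  refine ⟨2 * ((3 : ℕ) : ℚ)⁻¹ * (r₂ - r₁),
    mul_mem (mul_mem (ofNat_mem _ 2) hi3) (sub_mem hr₂ hr₁), ?_⟩
  push_cast
  linear_combination (2 / 3) * h₂

/-- The half sum of inverse cubes is `-2 * bernoulli (p - 3)` modulo `p`. -/
lemma exists_half_sum_inv_cube_eq {h : ℕ} (hp : p = 2 * h + 1) (hp3 : 3 < p) :
    ∃ r ∈ pIntegers p, ∑ k ∈ range h, (((k : ℚ) + 1) ^ 3)⁻¹ =
      -2 * bernoulli (p - 3) + p * r := by
  obtain ⟨n, rfl⟩ : ∃ n, h = n + 2 := ⟨h - 2, by lia⟩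
  have hp0 : (p : ℚ) ≠ 0 := Nat.cast_ne_zero.mpr (by lia)
  have hm : p - 3 = 2 * n + 2 := by lia
  have huv : ∀ x : ℕ, 0 < x → x < p → ∃ r ∈ pIntegers p,
      ((p : ℚ) - x) ^ (2 * n + 2) = (x : ℚ) ^ (2 * n + 2) +
        p * (-(2 * n + 2) * (x : ℚ) ^ (2 * n + 1)) + (p : ℚ) ^ 2 * r := by
    intro x _ _
    obtain ⟨z, hz⟩ := Polynomial.powAddExpansion (x : ℤ) (-p) (2 * n + 2)
    refine ⟨z, intCast_mem _ z, ?_⟩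
    rw [← Int.cast_inj (α := ℚ)] at hz
    push_cast at hz
    rw [show ((p : ℚ) - x) ^ (2 * n + 2) = (x + -p) ^ (2 * n + 2) by
      rw [← Even.neg_pow ⟨n + 1, by ring⟩]; ring, hz]
    ring
  obtain ⟨⟨r₁, hr₁, h₁⟩, r₂, hr₂, h₂⟩ :=
    exists_sum_reflect hp (u := fun x => x ^ (2 * n + 2))
      (v := fun x => -(2 * n + 2) * x ^ (2 * n + 1)) huv
  obtain ⟨r₃, hr₃, h₃⟩ := exists_sum_pow_eq (p := p) (m := 2 * n + 2) (by lia) (by lia)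
  obtain ⟨q, hq, ht⟩ := exists_pow_card_sub_one_eq (p := p) (x := 2) (by lia) (by lia)
  have hcube : ∀ k ∈ range (n + 2), ∃ r ∈ pIntegers p,
      (((k : ℚ) + 1) ^ 3)⁻¹ = ((k : ℚ) + 1) ^ (2 * n + 1) + p * r := by
    intro k hk
    have hk : k + 1 < p := by have := mem_range.mp hk; lia
    obtain ⟨r, hr, h⟩ := exists_pow_card_sub_one_eq k.succ_pos hk
    have hi := inv_natCast_mem_of_lt k.succ_pos hk
    have hk0 : (k + 1 : ℚ) ≠ 0 := by positivity
    rw [show p - 1 = 2 * n + 1 + 3 by lia, pow_add] at h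
    push_cast at h hi
    refine ⟨-r * ((k : ℚ) + 1)⁻¹ ^ 3, mul_mem (neg_mem hr) (pow_mem hi _), ?_⟩
    field_simp
    linear_combination -h
  obtain ⟨r₄, hr₄, h₄⟩ := exists_sum_eq_add_mul hcube
  have hB := bernoulli_mem (p := p) (n := 2 * n + 2) (by lia)
  have hpn : (p : ℚ) = 2 * n + 5 := by rw [hp]; push_cast; ring
  rw [h₃] at h₁ h₂
  rw [show p - 1 = 2 * n + 2 + 2 by lia, pow_add] at ht
  simp only [mul_pow, sum_add_distrib, ← mul_sum] at h₁ h₂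
  have h2pow : (2 : ℚ) ^ (2 * n + 2) = 2 ^ (2 * n + 1) * 2 := pow_succ _ _
  have hc : ∑ k ∈ range (n + 2), ((k : ℚ) + 1) ^ (2 * n + 1) ∈ pIntegers p :=
    sum_mem fun k _ => pow_mem (add_mem (natCast_mem _ _) (one_mem _)) _
  set c := ∑ k ∈ range (n + 2), ((k : ℚ) + 1) ^ (2 * n + 1)
  set a := ∑ k ∈ range (n + 2), ((k : ℚ) + 1) ^ (2 * n + 2)
  set t : ℚ := 2 ^ (2 * n + 1)
  set B := bernoulli (2 * n + 2)
  push_cast at ht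
  rw [h2pow] at h₂ ht
  have hn : (n : ℚ) = (p - 5) / 2 := by linarith
  have hi3 := inv_natCast_mem_of_lt (p := p) (n := 3) (by lia) (by lia)
  have htm : t ∈ pIntegers p := pow_mem (ofNat_mem _ 2) _
  have key : (2 * t - 1) * B + (p - 3) * t * c =
      p * (2 * t * r₁ - r₂ - (2 * t - 1) * r₃) := by
    apply mul_left_cancel₀ hp0
    rw [hn] at h₁ h₂
    linear_combination (2 * t) * h₁ - h₂
  push_cast at hi3
  refine ⟨3⁻¹ * (2 * q * B + c + (p - 3) * q * c -
      8 * (2 * t * r₁ - r₂ - (2 * t - 1) * r₃)) + r₄, ?_, ?_⟩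
  · have h2 := ofNat_mem (pIntegers p) 2
    have h8 := ofNat_mem (pIntegers p) 8
    have hpm : (p : ℚ) - 3 ∈ pIntegers p := sub_mem (natCast_mem _ _) (ofNat_mem _ 3)
    exact add_mem (mul_mem hi3 (sub_mem (add_mem (add_mem (mul_mem (mul_mem h2 hq) hB) hc)
      (mul_mem (mul_mem hpm hq) hc)) (mul_mem h8 (sub_mem (sub_mem
        (mul_mem (mul_mem h2 htm) hr₁) hr₂)
          (mul_mem (sub_mem (mul_mem h2 htm) (one_mem _)) hr₃))))) hr₄
  · rw [hm, h₄]
    linear_combination (-8 / 3) * key + (2 / 3 * B + (p - 3) / 3 * c) * ht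


/-- The sum of inverses of the first `p` odd numbers, in terms of a Bernoulli number. -/
lemma exists_sum_inv_odd_eq {h : ℕ} (hp : p = 2 * h + 1) (hp3 : 3 < p) :
    ∃ r ∈ pIntegers p, ∑ j ∈ range p, (p : ℚ) / (2 * j + 1) =
      1 - 7 / 6 * (p : ℚ) ^ 3 * bernoulli (p - 3) + (p : ℚ) ^ 4 * r := by
  have hpc : (2 * h + 1 : ℚ) = p := by rw [hp]; push_cast; rfl
  have hp0 : (p : ℚ) ≠ 0 := Nat.cast_ne_zero.mpr (by lia)
  have hi2 := inv_natCast_mem_of_lt (p := p) (n := 2) (by lia) (by lia)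
  have hi3 := inv_natCast_mem_of_lt (p := p) (n := 3) (by lia) (by lia)
  have hpair : ∀ k ∈ range h, ∃ r ∈ pIntegers p,
      (p : ℚ) / (p - 2 * (k + 1)) + p / (p + 2 * (k + 1)) =
        -((p : ℚ) ^ 2 / 2) * (((k : ℚ) + 1) ^ 2)⁻¹ + (p : ℚ) ^ 4 * r := by
    intro k hk
    have hk := mem_range.mp hk
    have h1 := inv_natCast_mem_of_lt (p := p) k.succ_pos (by lia)
    have h2 := inv_natCast_mem_of_lt (p := p) (n := p - 2 * (k + 1)) (by lia) (by lia)
    have h3 := inv_natCast_mem (p := p) (n := p + 2 * (k + 1)) fun hd =>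
      Nat.not_dvd_of_pos_of_lt (by lia) (by lia) ((Nat.dvd_add_right (dvd_refl p)).mp hd)
    have hlt : 2 * (k + 1) < p := by lia
    have h4 : (p : ℚ) - 2 * (k + 1) ≠ 0 := sub_ne_zero.mpr (by exact_mod_cast hlt.ne')
    have h5 : (p : ℚ) + 2 * (k + 1) ≠ 0 := by positivity
    push_cast [Nat.cast_sub hlt.le] at h1 h2 h3 hi2
    refine ⟨2⁻¹ * ((k : ℚ) + 1)⁻¹ ^ 2 * ((p : ℚ) - 2 * (k + 1))⁻¹ * ((p : ℚ) + 2 * (k + 1))⁻¹,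
      mul_mem (mul_mem (mul_mem hi2 (pow_mem h1 2)) h2) h3, ?_⟩
    field_simp
    ring
  obtain ⟨r₁, hr₁, h₁⟩ := exists_sum_eq_add_mul hpair
  obtain ⟨r₂, hr₂, h₂⟩ := exists_half_sum_inv_sq_eq hp hp3
  obtain ⟨r₃, hr₃, h₃⟩ := exists_half_sum_inv_cube_eq hp hp3
  have hsum := sum_range_two_mul_add_one_div_odd p h
  rw [← hp, hpc, div_self hp0, h₁, ← mul_sum, h₂, h₃] at hsum
  push_cast at hi2 hi3
  refine ⟨r₁ - 2⁻¹ * r₂ + 2⁻¹ * 2⁻¹ * 3⁻¹ * 7 * r₃, add_mem (sub_mem hr₁ (mul_mem hi2 hr₂))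
    (mul_mem (mul_mem (mul_mem (mul_mem hi2 hi2) hi3) (ofNat_mem _ 7)) hr₃), ?_⟩
  rw [hsum]
  ring

lemma H2_mem {k : ℕ} (hk : k < p) : H2 k ∈ pIntegers p := by
  refine sum_mem fun j hj => ?_
  have h := inv_natCast_mem_of_lt (p := p) j.succ_pos (by have := mem_range.mp hj; lia)
  push_cast at h
  rw [one_div, ← inv_pow]
  exact pow_mem h 2

lemma exists_choose_mul_choose_eq {N k : ℕ} (hN : N + 1 = p) (hk : k ≤ N) :
    ∃ r ∈ pIntegers p, (-1) ^ k * ((N.choose k : ℚ) * (N + 1 + k).choose k) =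
      1 - (p : ℚ) ^ 2 * H2 k + (p : ℚ) ^ 4 * r := by
  induction k with
  | zero => exact ⟨0, zero_mem _, by simp [H2]⟩
  | succ k ih =>
    obtain ⟨r, hr, h⟩ := ih (by lia)
    have hi := inv_natCast_mem_of_lt (p := p) k.succ_pos (by lia)
    have hH := H2_mem (p := p) (k := k) (by lia)
    have hk1 : (k + 1 : ℚ) ≠ 0 := by positivity
    have h1 := Nat.choose_succ_right_eq N k
    have h2 := Nat.add_one_mul_choose_eq (N + 1 + k) k
    rw [← Nat.cast_inj (R := ℚ)] at h1 h2
    have hpc : (N : ℚ) = p - 1 := by rw [← hN]; push_cast; ring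
    push_cast [Nat.cast_sub (show k ≤ N by lia)] at h1 h2 hi
    rw [hpc] at h1 h2
    have hH2 : H2 (k + 1) = H2 k + ((k : ℚ) + 1)⁻¹ ^ 2 := by
      rw [H2, sum_range_succ, ← H2, inv_pow, one_div]
    refine ⟨r - r * (p : ℚ) ^ 2 * ((k : ℚ) + 1)⁻¹ ^ 2 + H2 k * ((k : ℚ) + 1)⁻¹ ^ 2,
      add_mem (sub_mem hr (mul_mem (mul_mem hr (pow_mem (natCast_mem _ _) 2)) (pow_mem hi 2)))
        (mul_mem hH (pow_mem hi 2)), ?_⟩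
    have hstep : (-1) ^ (k + 1) * ((N.choose (k + 1) : ℚ) * (N + 1 + (k + 1)).choose (k + 1)) =
        (-1) ^ k * ((N.choose k : ℚ) * (N + 1 + k).choose k) *
          (1 - (p : ℚ) ^ 2 * ((k : ℚ) + 1)⁻¹ ^ 2) := by
      rw [← add_assoc (N + 1) k 1]
      field_simp
      rw [pow_succ]
      linear_combination (-1) ^ k * (-((N + 1 + k + 1).choose (k + 1) : ℚ) * (k + 1) * h1 +
        (N.choose k : ℚ) * (p - 1 - k) * h2)
    rw [hstep, h, hH2]
    ring

lemma div_odd_mem {j : ℕ} (hj : j < p) : (p : ℚ) / (2 * j + 1) ∈ pIntegers p := by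
  by_cases hd : p ∣ 2 * j + 1
  · obtain ⟨c, hc⟩ := hd
    have hc1 : c = 1 := by
      have : c < 2 := Nat.lt_of_mul_lt_mul_left (a := p) (by lia)
      have : c ≠ 0 := by rintro rfl; simp at hc
      lia
    have hp0 : (p : ℚ) ≠ 0 := Nat.cast_ne_zero.mpr (by lia)
    rw [show (2 * j + 1 : ℚ) = p by rw [hc1, mul_one] at hc; exact_mod_cast hc, div_self hp0]
    exact one_mem _
  · have h := inv_natCast_mem hd
    push_cast at h
    exact mul_mem (natCast_mem _ _) h

end pIntegers

open pIntegers in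
theorem sum_g_bernoulli (p : ℕ) (hp : p.Prime) (hp3 : 3 < p) :
    ratCongr p 4
      (∑ k ∈ Finset.Icc 1 (p - 1), (g k : ℚ))
      ((p : ℚ) ^ 2 * ∑ k ∈ Finset.Icc 1 (p - 1), (g k : ℚ) * H2 k
        + 7 / 6 * (p : ℚ) ^ 3 * bernoulli (p - 3)) := by
  have : Fact p.Prime := ⟨hp⟩
  obtain ⟨h, hh⟩ := hp.odd_of_ne_two (by lia)
  have hN : 2 * h + 1 = p := hh.symm
  have hpc : ((2 * h : ℕ) + 1 : ℚ) = p := by exact_mod_cast hN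
  let Q : ℕ → ℚ := fun k => (-1) ^ k * (((2 * h).choose k : ℚ) * (2 * h + 1 + k).choose k)
  have hle {k : ℕ} (hk : k ∈ range p) : k ≤ 2 * h := by have := mem_range.mp hk; lia
  have hQ (k : ℕ) (hk : k ∈ range p) : ∃ r ∈ pIntegers p,
      Q k = 1 - (p : ℚ) ^ 2 * H2 k + (p : ℚ) ^ 4 * r := exists_choose_mul_choose_eq hN (hle hk)
  have hgQ : ∀ k ∈ range p, ∃ r ∈ pIntegers p,
      Q k * g k = (g k - (p : ℚ) ^ 2 * (g k * H2 k)) + (p : ℚ) ^ 4 * r := by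
    intro k hk
    obtain ⟨r, hr, h⟩ := hQ k hk
    exact ⟨r * g k, mul_mem hr (intCast_mem _ _), by rw [h]; ring⟩
  have hsq : ∀ j ∈ range p, ∃ r ∈ pIntegers p,
      (p : ℚ) / (2 * j + 1) * ((2 * h).choose j * (2 * h + 1 + j).choose j) ^ 2 =
        (2 * (Q j * (p / (2 * j + 1))) - p / (2 * j + 1)) + (p : ℚ) ^ 4 * r := by
    intro j hj
    obtain ⟨r, hr, h'⟩ := hQ j hj
    have hQ2 : (((2 * h).choose j : ℚ) * (2 * h + 1 + j).choose j) ^ 2 = Q j ^ 2 := by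
      simp only [Q]
      rw [mul_pow ((-1) ^ j), ← pow_mul, mul_comm j 2, pow_mul]
      simp
    have hj' := mem_range.mp hj
    refine ⟨(p : ℚ) / (2 * j + 1) * ((p : ℚ) ^ 2 * r - H2 j) ^ 2, mul_mem (div_odd_mem hj')
      (pow_mem (sub_mem (mul_mem (pow_mem (natCast_mem _ _) 2) hr) (H2_mem hj')) 2), ?_⟩
    rw [hQ2, h']
    ring
  obtain ⟨r₁, hr₁, h₁⟩ := exists_sum_eq_add_mul hgQ
  obtain ⟨r₂, hr₂, h₂⟩ := exists_sum_eq_add_mul hsq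
  obtain ⟨r₃, hr₃, h₃⟩ := exists_sum_inv_odd_eq hh hp3
  have hI := sum_choose_mul_choose_mul_g (even_two_mul h)
  have hJ := sum_choose_mul_choose_succ_add_div h
  rw [hpc, hN] at hI
  rw [show (2 * h + 1 : ℚ) = p by exact_mod_cast hN, hN] at hJ
  rw [sum_sub_distrib, ← mul_sum] at h₁ h₂
  have hIcc (f : ℕ → ℚ) : ∑ k ∈ Icc 1 (p - 1), f k = ∑ k ∈ range p, f k - f 0 := by
    rw [range_eq_Ico, sum_eq_sum_Ico_succ_bot hp.pos, add_sub_cancel_left]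
    congr 1
  have hg0 : g 0 = 1 := by simp [g]
  refine ratCongr_of_sub_eq (r := r₂ - r₃ - r₁) (sub_mem (sub_mem hr₂ hr₃) hr₁) ?_
  rw [hIcc, hIcc, hg0, show H2 0 = 0 from rfl]
  push_cast
  simp only [Q, hN] at h₁ h₂
  rw [hI] at h₁
  rw [hJ] at h₂
  linear_combination h₂ - h₁ - h₃
end

section
/- Let p > 3 be a prime. Then ∑_{k=1}^{p-1} g_{k-1}/k ≡ −(p/3)·2·q_p(3) (mod p). -/
/-- The Fermat quotient `q_p(a) = (a^{p-1} - 1)/p`. -/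
def fermatQuot (p : ℕ) (a : ℤ) : ℚ := ((a : ℚ) ^ (p - 1) - 1) / (p : ℚ)

open Finset Polynomial in
/-- The sum of the values of a polynomial of degree less than `q - 1` over a field with `q`
elements vanishes. -/
lemma sum_eval_eq_zero_of_natDegree_lt {K : Type*} [Field K] [Fintype K] (Q : K[X])
    (hQ : Q.natDegree < Fintype.card K - 1) : ∑ x : K, Q.eval x = 0 := by
  simp_rw [eval_eq_sum_range]
  rw [sum_comm]
  refine sum_eq_zero fun i hi => ?_
  rw [← mul_sum, FiniteField.sum_pow_lt_card_sub_one K i (by rw [mem_range] at hi; omega),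
    mul_zero]

open Finset Polynomial in
/-- For a polynomial of small degree, summing `P(x) / x` over the nonzero elements of a finite
field extracts the linear coefficient. -/
lemma sum_eval_mul_inv {K : Type*} [Field K] [Fintype K] (P : K[X])
    (hK : 2 < Fintype.card K) (hP : P.natDegree < Fintype.card K) :
    ∑ x : K, P.eval x * x⁻¹ = -P.coeff 1 := by
  classical
  have hinv : ∑ x : K, x⁻¹ = 0 := by
    rw [inv_involutive.bijective.sum_comp fun x : K => x]
    simpa using FiniteField.sum_pow_lt_card_sub_one K 1 (by omega)
  have hQ : ∑ x : K, P.divX.eval x = 0 := by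
    refine sum_eval_eq_zero_of_natDegree_lt _ ?_
    rw [natDegree_divX_eq_natDegree_tsub_one]
    omega
  have hx (x : K) : P.eval x * x⁻¹
      = P.divX.eval x + P.coeff 0 * x⁻¹ - if x = 0 then P.coeff 1 else 0 := by
    conv_lhs => rw [← divX_mul_X_add P]
    by_cases h : x = 0
    · subst h
      simp [← coeff_zero_eq_eval_zero]
    · simp [h, add_mul]
  simp_rw [hx, sum_sub_distrib, sum_add_distrib, ← mul_sum, hinv, hQ]
  simp

open Finset in
/-- Summation over `ZMod p` in terms of natural-number representatives. -/
lemma sum_zmod_eq_sum_range {M : Type*} [AddCommMonoid M] (p : ℕ) [NeZero p] (f : ZMod p → M) :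
    ∑ x : ZMod p, f x = ∑ k ∈ range p, f (k : ZMod p) := by
  refine sum_nbij' ZMod.val (fun k => (k : ZMod p)) ?_ ?_ ?_ ?_ ?_
  · intro x _
    simpa using ZMod.val_lt x
  · simp
  · simp
  · intro k hk
    exact ZMod.val_cast_of_lt (by simpa using hk)
  · simp

/-- A positive natural number below `p` is nonzero modulo `p`. -/
lemma natCast_succ_ne_zero {p i : ℕ} (hi : i + 1 < p) : ((i : ZMod p) + 1) ≠ 0 := by
  intro h
  have : ((i + 1 : ℕ) : ZMod p) = 0 := by exact_mod_cast h
  rw [ZMod.natCast_eq_zero_iff] at this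
  exact absurd (Nat.le_of_dvd (by omega) this) (by omega)

/-- The recurrence of binomial coefficients in the lower index, without subtraction. -/
lemma choose_succ_cast {R : Type*} [CommRing R] (m j : ℕ) :
    (m.choose (j + 1) : R) * (j + 1) = m.choose j * (m - j) := by
  have h := Nat.choose_succ_right_eq m j
  rcases le_or_gt j m with hj | hj
  · have := congrArg (Nat.cast : ℕ → R) h
    push_cast [Nat.cast_sub hj] at this
    exact this
  · rw [Nat.choose_eq_zero_of_lt hj, Nat.choose_eq_zero_of_lt (by omega)]
    simp

open Finset Polynomial in
/-- The sum of `(k-1 choose j)² / k` over `0 < k < p` is twice a harmonic number modulo `p`. -/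
lemma sum_choose_sq_div {p : ℕ} [Fact p.Prime] (hp : 2 < p) {j : ℕ} (hj : 2 * j < p) :
    ∑ m ∈ range (p - 1), (m.choose j : ZMod p) ^ 2 * ((m : ZMod p) + 1)⁻¹
      = 2 * ∑ i ∈ range j, ((i : ZMod p) + 1)⁻¹ := by
  let P : ℕ → (ZMod p)[X] := fun j => ∏ i ∈ range j, (1 - C ((i : ZMod p) + 1)⁻¹ * X) ^ 2
  have hdeg (j : ℕ) : (P j).natDegree ≤ 2 * j := by
    refine (natDegree_prod_le _ _).trans ?_
    refine (sum_le_card_nsmul _ _ 2 fun i _ => ?_).trans (by simp [mul_comm])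
    compute_degree
  have hcoeff (j : ℕ) : (P j).coeff 0 = 1 ∧
      (P j).coeff 1 = -(2 * ∑ i ∈ range j, ((i : ZMod p) + 1)⁻¹) := by
    induction j with
    | zero => simp [P, coeff_one]
    | succ j ih =>
      have hs : P (j + 1) = P j - P j * C (2 * ((j : ZMod p) + 1)⁻¹) * X
          + P j * C (((j : ZMod p) + 1)⁻¹ ^ 2) * X * X := by
        simp only [P, prod_range_succ]
        rw [C_mul, C_pow, show (C (2 : ZMod p)) = 2 from rfl]
        ring
      rw [hs, sum_range_succ]
      have h1 := coeff_mul_X (P j * C (2 * ((j : ZMod p) + 1)⁻¹)) 0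
      have h2 := coeff_mul_X (P j * C (((j : ZMod p) + 1)⁻¹ ^ 2) * X) 0
      simp only [zero_add] at h1 h2
      refine ⟨by simp [ih.1], ?_⟩
      rw [coeff_add, coeff_sub, h1, h2, coeff_mul_C, ih.1, ih.2]
      simp
      ring
  have heval (m j : ℕ) (hj : j < p) :
      (P j).eval ((m : ZMod p) + 1) = (m.choose j : ZMod p) ^ 2 := by
    induction j with
    | zero => simp [P]
    | succ j ih =>
      have hne := natCast_succ_ne_zero hj
      have h := choose_succ_cast (R := ZMod p) m j
      have h' : (m.choose (j + 1) : ZMod p) = m.choose j * (m - j) * ((j : ZMod p) + 1)⁻¹ := by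
        rw [← h, mul_assoc, mul_inv_cancel₀ hne, mul_one]
      have hs : P (j + 1) = P j * (1 - C ((j : ZMod p) + 1)⁻¹ * X) ^ 2 := by
        simp only [P, prod_range_succ]
      rw [hs, eval_mul, ih (by omega), h']
      simp
      field_simp
      ring
  have key := sum_eval_mul_inv (P j) (by rwa [ZMod.card]) (by
    rw [ZMod.card]; exact (hdeg j).trans_lt hj)
  rw [(hcoeff j).2, neg_neg, sum_zmod_eq_sum_range] at key
  rw [← key]
  obtain ⟨q, rfl⟩ : ∃ q, p = q + 1 := ⟨p - 1, by omega⟩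
  rw [sum_range_succ', Nat.add_sub_cancel]
  simp only [Nat.cast_zero, inv_zero, mul_zero, add_zero]
  refine sum_congr rfl fun m _ => ?_
  rw [Nat.cast_succ, heval m j (by omega)]

/-- `(2j choose j) ≡ (n choose j) (-4)^j` modulo `p = 2n + 1`. -/
lemma centralBinom_zmod {p n j : ℕ} [Fact p.Prime] (hn : p = 2 * n + 1) (hj : j < p) :
    ((2 * j).choose j : ZMod p) = n.choose j * (-4) ^ j := by
  induction j with
  | zero => simp
  | succ j ih =>
    have hne := natCast_succ_ne_zero hj
    have h1 := congrArg (Nat.cast : ℕ → ZMod p) (Nat.succ_mul_centralBinom_succ j)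
    have h2 := choose_succ_cast (R := ZMod p) n j
    have hp : (2 * n + 1 : ZMod p) = 0 := by
      have h := congrArg (Nat.cast : ℕ → ZMod p) hn
      rw [ZMod.natCast_self] at h
      exact_mod_cast h.symm
    simp only [Nat.centralBinom] at h1
    push_cast at h1
    rw [ih (by omega)] at h1
    refine mul_left_cancel₀ hne ?_
    rw [h1, pow_succ]
    linear_combination (4 * (-4) ^ j) * h2 + 2 * n.choose j * (-4) ^ j * hp

open Finset in
/-- A binomial transform of the harmonic numbers, valid modulo `p`. -/
lemma sum_choose_mul_pow_mul_harmonic {p n : ℕ} [Fact p.Prime] (hn : n < p) (y : ZMod p)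
    (hy : y ≠ 0) :
    ∑ j ∈ range (n + 1), (n.choose j : ZMod p) * (y - 1) ^ j
        * ∑ i ∈ range j, ((i : ZMod p) + 1)⁻¹
      = y ^ n * ∑ i ∈ range n, (1 - (y⁻¹) ^ (i + 1)) * ((i : ZMod p) + 1)⁻¹ := by
  induction n with
  | zero => simp
  | succ n ih =>
    have hne := natCast_succ_ne_zero hn
    set H : ℕ → ZMod p := fun j => ∑ i ∈ range j, ((i : ZMod p) + 1)⁻¹ with hH
    have hHs (j : ℕ) : H (j + 1) = H j + ((j : ZMod p) + 1)⁻¹ := sum_range_succ _ _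
    have hH0 : H 0 = 0 := sum_range_zero _
    have ih' := ih (by omega)
    change ∑ j ∈ range (n + 1), (n.choose j : ZMod p) * (y - 1) ^ j * H j = _ at ih'
    change ∑ j ∈ range (n + 1 + 1), ((n + 1).choose j : ZMod p) * (y - 1) ^ j * H j = _
    have hbin : ∑ j ∈ range (n + 1), (n.choose j : ZMod p) * (y - 1) ^ (j + 1)
        * ((j : ZMod p) + 1)⁻¹ = (y ^ (n + 1) - 1) * ((n : ZMod p) + 1)⁻¹ := by
      have h := add_pow (y - 1) 1 (n + 1)
      rw [sum_range_succ'] at h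
      simp only [sub_add_cancel, one_pow, mul_one, pow_zero, Nat.choose_zero_right,
        Nat.cast_one] at h
      rw [h, add_sub_cancel_right, sum_mul]
      refine sum_congr rfl fun j hj => ?_
      have hje := natCast_succ_ne_zero (p := p) (i := j) (by rw [mem_range] at hj; omega)
      have hc := congrArg (Nat.cast : ℕ → ZMod p) (Nat.add_one_mul_choose_eq n j)
      push_cast at hc
      field_simp
      linear_combination (y - 1) ^ (j + 1) * hc
    have hshift : ∑ j ∈ range (n + 1), (n.choose (j + 1) : ZMod p) * (y - 1) ^ (j + 1) * H (j + 1)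
        = ∑ j ∈ range (n + 1), (n.choose j : ZMod p) * (y - 1) ^ j * H j := by
      have h := sum_range_succ' (fun j => (n.choose j : ZMod p) * (y - 1) ^ j * H j) (n + 1)
      rw [sum_range_succ] at h
      simpa [hH0] using h.symm
    have hrec : ∑ j ∈ range (n + 1 + 1), ((n + 1).choose j : ZMod p) * (y - 1) ^ j * H j
        = y * ∑ j ∈ range (n + 1), (n.choose j : ZMod p) * (y - 1) ^ j * H j
          + (y ^ (n + 1) - 1) * ((n : ZMod p) + 1)⁻¹ := by
      rw [sum_range_succ', hH0, mul_zero, add_zero, ← hbin]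
      have : ∀ j, ((n + 1).choose (j + 1) : ZMod p) * (y - 1) ^ (j + 1) * H (j + 1)
          = (n.choose (j + 1) : ZMod p) * (y - 1) ^ (j + 1) * H (j + 1)
            + ((y - 1) * ((n.choose j : ZMod p) * (y - 1) ^ j * H j)
              + (n.choose j : ZMod p) * (y - 1) ^ (j + 1) * ((j : ZMod p) + 1)⁻¹) := by
        intro j
        rw [Nat.choose_succ_succ, hHs]
        push_cast
        ring
      simp_rw [this, sum_add_distrib, ← mul_sum, hshift]
      ring
    rw [hrec, ih', sum_range_succ, mul_add, pow_succ' y n, mul_assoc]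
    congr 1
    rw [inv_pow, pow_succ' y n]
    field_simp

open Finset in
/-- The `√d`-coefficient of an odd power of `1 + √d`. -/
lemma im_one_add_sqrtd_pow (d : ℤ) (n : ℕ) :
    ((1 + Zsqrtd.sqrtd : ℤ√d) ^ (2 * n + 1)).im
      = ∑ j ∈ range (n + 1), ((2 * n + 1).choose (2 * j) : ℤ) * d ^ (n - j) := by
  have hpair (f : ℕ → ℤ√d) (N : ℕ) :
      ∑ k ∈ range (2 * N), f k = ∑ i ∈ range N, (f (2 * i) + f (2 * i + 1)) := by
    induction N with
    | zero => simp
    | succ N ih => rw [mul_add, mul_one, sum_range_succ, sum_range_succ, ih, sum_range_succ]; ring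
  have hsq (m : ℕ) : (Zsqrtd.sqrtd : ℤ√d) ^ (2 * m) = ((d ^ m : ℤ) : ℤ√d) := by
    rw [pow_mul, pow_two, Zsqrtd.dmuld, Int.cast_pow]
  have h : (1 + Zsqrtd.sqrtd : ℤ√d) ^ (2 * n + 1)
      = ((∑ j ∈ range (n + 1), ((2 * n + 1).choose (2 * j + 1) : ℤ) * d ^ (n - j) : ℤ) : ℤ√d)
        + ((∑ j ∈ range (n + 1), ((2 * n + 1).choose (2 * j) : ℤ) * d ^ (n - j) : ℤ) : ℤ√d)
          * Zsqrtd.sqrtd := by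
    rw [add_pow, show 2 * n + 1 + 1 = 2 * (n + 1) by ring, hpair, Int.cast_sum, Int.cast_sum,
      sum_mul, ← sum_add_distrib]
    refine sum_congr rfl fun j hj => ?_
    rw [mem_range] at hj
    rw [show 2 * n + 1 - 2 * j = 2 * (n - j) + 1 by omega,
      show 2 * n + 1 - (2 * j + 1) = 2 * (n - j) by omega, pow_succ, hsq]
    push_cast
    ring
  rw [h]
  simp [-Int.cast_sum]

open Finset in
/-- The even-index binomial sum modulo `p²`, with the first order term made explicit. -/
lemma exists_sum_choose_even {p n : ℕ} [Fact p.Prime] (hn : p = 2 * n + 1) (d : ℤ)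
    (hd : (d : ZMod p) ≠ 0) :
    ∃ T : ℤ, ((1 + Zsqrtd.sqrtd : ℤ√d) ^ p).im = d ^ n + p * T ∧
      2 * (T : ZMod p) = -((d : ZMod p) ^ n
        * ∑ i ∈ range n, ((d : ZMod p)⁻¹) ^ (i + 1) * ((i : ZMod p) + 1)⁻¹) := by
  have hp : p.Prime := Fact.out
  refine ⟨∑ i ∈ range n, ((p.choose (2 * (i + 1)) / p : ℕ) : ℤ) * d ^ (n - (i + 1)), ?_, ?_⟩
  · have him := im_one_add_sqrtd_pow d n
    rw [← hn] at him
    rw [him, sum_range_succ', add_comm, mul_sum]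
    congr 1
    · simp
    · refine sum_congr rfl fun i hi => ?_
      rw [mem_range] at hi
      have hdvd : p ∣ p.choose (2 * (i + 1)) :=
        hp.dvd_choose_self (by omega) (by omega)
      rw [← mul_assoc, ← Nat.cast_mul, Nat.mul_div_cancel' hdvd]
  · simp only [Int.cast_sum, Int.cast_mul, Int.cast_pow, Int.cast_natCast]
    rw [mul_sum, mul_sum, ← sum_neg_distrib]
    refine sum_congr rfl fun i hi => ?_
    rw [mem_range] at hi
    have hdvd : p ∣ p.choose (2 * (i + 1)) :=
      hp.dvd_choose_self (by omega) (by omega)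
    have hne := natCast_succ_ne_zero (p := p) (i := i) (by omega)
    have hE : p.choose (2 * (i + 1)) / p * (2 * (i + 1)) = (p - 1).choose (2 * i + 1) := by
      refine Nat.eq_of_mul_eq_mul_left hp.pos ?_
      have h := Nat.add_one_mul_choose_eq (p - 1) (2 * i + 1)
      rw [Nat.sub_add_cancel hp.one_le] at h
      rw [h, ← mul_assoc, Nat.mul_div_cancel' hdvd]
      rfl
    have hodd (j : ℕ) (hj : j < p) : ((p - 1).choose j : ZMod p) = (-1) ^ j := by
      induction j with
      | zero => simp
      | succ j ih =>
        have h := choose_succ_cast (R := ZMod p) (p - 1) j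
        rw [ih (by omega), Nat.cast_sub hp.one_le, ZMod.natCast_self] at h
        refine mul_right_cancel₀ (natCast_succ_ne_zero hj) ?_
        rw [h]
        push_cast
        ring
    have hE' := congrArg (Nat.cast : ℕ → ZMod p) hE
    rw [hodd _ (by omega), pow_succ, pow_mul] at hE'
    push_cast at hE'
    norm_num at hE'
    have hdp : (d : ZMod p) ^ n * ((d : ZMod p)⁻¹) ^ (i + 1) = (d : ZMod p) ^ (n - (i + 1)) := by
      rw [inv_pow, ← div_eq_mul_inv, div_eq_iff (pow_ne_zero _ hd), ← pow_add,
        Nat.sub_add_cancel (by omega)]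
    rw [← mul_assoc ((d : ZMod p) ^ n), hdp, ← mul_assoc]
    refine mul_right_cancel₀ hne ?_
    rw [neg_mul, mul_assoc ((d : ZMod p) ^ (n - (i + 1))), inv_mul_cancel₀ hne]
    linear_combination (d : ZMod p) ^ (n - (i + 1)) * hE'

/-- The `√1`-coefficient of a power of `1 + √1`. -/
lemma one_add_sqrtd_one_pow (m : ℕ) :
    ((1 + Zsqrtd.sqrtd : ℤ√1) ^ (m + 1)) = ((2 ^ m : ℤ) : ℤ√1) * (1 + Zsqrtd.sqrtd) := by
  induction m with
  | zero => simp
  | succ m ih =>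
    have h : (1 + Zsqrtd.sqrtd : ℤ√1) * (1 + Zsqrtd.sqrtd) = 2 * (1 + Zsqrtd.sqrtd) := by
      ext <;> simp
    rw [pow_succ, ih, mul_assoc, h]
    push_cast
    ring

/-- The `√-3`-coefficient of a power of `1 + √-3` with exponent prime to `6`. -/
lemma im_one_add_sqrtd_neg_three_pow {p : ℕ} (h2 : p % 2 = 1) (h3 : p % 3 ≠ 0) :
    ((1 + Zsqrtd.sqrtd : ℤ√(-3)) ^ p).im = legendreSym 3 p * 2 ^ (p - 1) := by
  have h6 : (1 + Zsqrtd.sqrtd : ℤ√(-3)) ^ 6 = ((64 : ℤ) : ℤ√(-3)) := by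
    ext <;> decide
  have h64 (m : ℕ) : (2 : ℤ) ^ (6 * m) = 64 ^ m := by
    rw [pow_mul]; norm_num
  have hr : p % 6 = 1 ∨ p % 6 = 5 := by omega
  rw [legendreSym.mod]
  rcases hr with hr | hr
  · obtain ⟨m, rfl⟩ : ∃ m, p = 6 * m + 1 := ⟨p / 6, by omega⟩
    have hl : (((6 * m + 1 : ℕ) : ℤ) % (3 : ℕ)) = 1 := by push_cast; omega
    rw [hl, pow_succ, pow_mul, h6, Nat.add_sub_cancel, h64, ← Int.cast_pow]
    generalize (64 : ℤ) ^ m = c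
    simp
  · obtain ⟨m, rfl⟩ : ∃ m, p = 6 * m + 5 := ⟨p / 6, by omega⟩
    have hl : (((6 * m + 5 : ℕ) : ℤ) % (3 : ℕ)) = 2 := by push_cast; omega
    have h5 : (1 + Zsqrtd.sqrtd : ℤ√(-3)) ^ 5 = ⟨16, -16⟩ := by
      ext <;> decide
    have hs : legendreSym 3 2 = -1 := by decide
    rw [hl, pow_add, pow_mul, h6, h5, show 6 * m + 5 - 1 = 6 * m + 4 by omega, pow_add 2, h64, hs,
      ← Int.cast_pow]
    generalize (64 : ℤ) ^ m = c
    simp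

open Finset in
/-- The congruence for `∑ g_{k-1} / k`, read in `ZMod p`. -/
lemma sum_g_div_zmod {p : ℕ} [Fact p.Prime] (hp3 : 3 < p) {Q : ℤ}
    (hQ : (p : ℤ) * Q = 3 ^ (p - 1) - 1) :
    ∑ m ∈ range (p - 1), (g m : ZMod p) * ((m : ZMod p) + 1)⁻¹
      = -(legendreSym 3 p : ZMod p) * 2 * (Q : ZMod p) := by
  have hp : p.Prime := Fact.out
  have h2 : p % 2 = 1 := hp.eq_two_or_odd.resolve_left (by omega)
  have h3 : p % 3 ≠ 0 := fun h => by
    have := (Nat.prime_dvd_prime_iff_eq Nat.prime_three hp).1 (Nat.dvd_of_mod_eq_zero h)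
    omega
  obtain ⟨n, hn⟩ : ∃ n, p = 2 * n + 1 := ⟨p / 2, by omega⟩
  have hpz : (p : ℤ) ≠ 0 := by exact_mod_cast hp.ne_zero
  have h3ne : (-3 : ZMod p) ≠ 0 := by
    have := natCast_succ_ne_zero (p := p) (i := 2) (by omega)
    norm_num at this
    simpa using this
  have hsum : ∑ m ∈ range (p - 1), (g m : ZMod p) * ((m : ZMod p) + 1)⁻¹
      = 2 * ((-3) ^ n * ∑ i ∈ range n, (1 - ((-3 : ZMod p)⁻¹) ^ (i + 1))
          * ((i : ZMod p) + 1)⁻¹) := by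
    have hg (m : ℕ) (hm : m < p) : (g m : ZMod p)
        = ∑ j ∈ range (n + 1), (m.choose j : ZMod p) ^ 2 * (n.choose j * (-4) ^ j) := by
      have e1 : (g m : ZMod p) = ∑ j ∈ range p, (m.choose j : ZMod p) ^ 2
          * (n.choose j * (-4) ^ j) := by
        simp only [g]
        push_cast
        rw [← sum_subset (range_subset_range.2 (show m + 1 ≤ p from hm))]
        · refine sum_congr rfl fun j hj => ?_
          rw [centralBinom_zmod hn (by rw [mem_range] at hj; omega)]
        · intro j _ hj
          rw [mem_range, not_lt] at hj
          simp [Nat.choose_eq_zero_of_lt hj]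
      rw [e1]
      symm
      refine sum_subset (range_subset_range.2 (by omega)) fun j _ hj => ?_
      rw [mem_range, not_lt] at hj
      simp [Nat.choose_eq_zero_of_lt hj]
    rw [← sum_choose_mul_pow_mul_harmonic (by omega) (-3) h3ne, mul_sum]
    have : ∀ m ∈ range (p - 1), (g m : ZMod p) * ((m : ZMod p) + 1)⁻¹
        = ∑ j ∈ range (n + 1), (n.choose j * (-4) ^ j : ZMod p)
          * ((m.choose j : ZMod p) ^ 2 * ((m : ZMod p) + 1)⁻¹) := by
      intro m hm
      rw [mem_range] at hm
      rw [hg m (by omega), sum_mul]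
      exact sum_congr rfl fun j _ => by ring
    rw [sum_congr rfl this, sum_comm]
    refine sum_congr rfl fun j hj => ?_
    rw [mem_range] at hj
    rw [← mul_sum, sum_choose_sq_div (by omega) (by omega)]
    norm_num
    ring
  obtain ⟨T₁, hT₁, hT₁'⟩ := exists_sum_choose_even hn 1 (by simp)
  obtain ⟨T₃, hT₃, hT₃'⟩ := exists_sum_choose_even hn (-3) (by simpa using h3ne)
  have him1 : ((1 + Zsqrtd.sqrtd : ℤ√1) ^ p).im = 2 ^ (p - 1) := by
    obtain ⟨q, hq⟩ : ∃ q, p = q + 1 := ⟨p - 1, by omega⟩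
    rw [hq, one_add_sqrtd_one_pow, Nat.add_sub_cancel]
    generalize (2 : ℤ) ^ q = c
    simp
  rw [him1, one_pow] at hT₁
  rw [im_one_add_sqrtd_neg_three_pow h2 h3, hT₁] at hT₃
  have hl : (legendreSym 3 p) ^ 2 = 1 := by
    refine legendreSym.sq_one 3 ?_
    intro h
    have : (3 : ℤ) ∣ (p : ℤ) := (ZMod.intCast_zmod_eq_zero_iff_dvd _ _).1 h
    omega
  have hlz : (legendreSym 3 p : ZMod p) = (-3) ^ n := by
    have := congrArg (Int.cast : ℤ → ZMod p) hT₃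
    push_cast at this
    simpa using this
  have hlz2 : ((-3 : ZMod p) ^ n) ^ 2 = 1 := by
    rw [← hlz]
    exact_mod_cast congrArg (Int.cast : ℤ → ZMod p) hl
  have h9 : ((-3 : ℤ) ^ n) ^ 2 = 3 ^ (p - 1) := by
    rw [← pow_mul, mul_comm, pow_mul, hn, Nat.add_sub_cancel, pow_mul]
    norm_num
  have hQT : Q + 2 * (-3) ^ n * T₃ + p * T₃ ^ 2 = 2 * T₁ + p * T₁ ^ 2 := by
    refine mul_left_cancel₀ hpz ?_
    have hsq := congrArg (· ^ 2) hT₃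
    simp only [mul_pow, hl] at hsq
    linear_combination hQ - h9 - hsq
  have hQT' := congrArg (Int.cast : ℤ → ZMod p) hQT
  push_cast at hQT' hT₁' hT₃'
  simp only [CharP.cast_eq_zero, zero_mul, add_zero, inv_one, one_pow, one_mul] at hQT' hT₁'
  rw [hsum, hlz]
  simp_rw [sub_mul, sum_sub_distrib, one_mul]
  set S := ∑ i ∈ range n, ((-3 : ZMod p)⁻¹) ^ (i + 1) * ((i : ZMod p) + 1)⁻¹
  linear_combination 2 * (-3) ^ n * hT₁' + 2 * (-3) ^ n * (hQT' - (-3) ^ n * hT₃')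
    + 2 * (-3) ^ n * S * hlz2

theorem sum_g_pred_div_k (p : ℕ) (hp : p.Prime) (hp3 : 3 < p) :
    ratCongr p 1 (∑ k ∈ Finset.Icc 1 (p - 1), (g (k - 1) : ℚ) / (k : ℚ))
      (-(legendreSym 3 p : ℚ) * 2 * fermatQuot p 3) := by
  have : Fact p.Prime := ⟨hp⟩
  have hpQ : (p : ℚ) ≠ 0 := by exact_mod_cast hp.ne_zero
  obtain ⟨Q, hQ⟩ : (p : ℤ) ∣ 3 ^ (p - 1) - 1 := by
    refine (Int.ModEq.pow_card_sub_one_eq_one hp ?_).symm.dvd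
    exact_mod_cast (Nat.coprime_primes Nat.prime_three hp).2 (by omega)
  have hF : fermatQuot p 3 = Q := by
    rw [fermatQuot, div_eq_iff hpQ, mul_comm]
    exact_mod_cast hQ
  have key := sum_g_div_zmod hp3 hQ.symm
  have hS : ∑ k ∈ Finset.Icc 1 (p - 1), (g (k - 1) : ℚ) / (k : ℚ)
      = ∑ m ∈ Finset.range (p - 1), (g m : ℚ) / ((m : ℚ) + 1) := by
    refine Finset.sum_nbij' (· - 1) (· + 1) ?_ ?_ ?_ ?_ ?_
    all_goals
      intro k hk
      simp only [Finset.mem_Icc, Finset.mem_range] at hk ⊢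
    · omega
    · omega
    · omega
    · omega
    · rw [Nat.cast_sub hk.1, Nat.cast_one, sub_add_cancel]
  set D : ℕ := (p - 1).factorial with hD
  have hDp : ¬ p ∣ D := by
    rw [hD, hp.dvd_factorial]
    have := hp.pos
    omega
  have hdiv (m : ℕ) (hm : m ∈ Finset.range (p - 1)) : D / (m + 1) * (m + 1) = D := by
    rw [Finset.mem_range] at hm
    exact Nat.div_mul_cancel (Nat.dvd_factorial (by omega) (by omega))
  set N : ℤ := ∑ m ∈ Finset.range (p - 1), g m * ((D / (m + 1) : ℕ) : ℤ)
  have hNQ : (N : ℚ) = D * ∑ m ∈ Finset.range (p - 1), (g m : ℚ) / ((m : ℚ) + 1) := by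
    rw [Int.cast_sum, Finset.mul_sum]
    refine Finset.sum_congr rfl fun m hm => ?_
    have h := congrArg (Nat.cast : ℕ → ℚ) (hdiv m hm)
    have hm1 : (m : ℚ) + 1 ≠ 0 := by positivity
    rw [← h, Int.cast_mul, Int.cast_natCast, Nat.cast_mul, Nat.cast_succ]
    field_simp
  have hNZ : (N : ZMod p) = D * ∑ m ∈ Finset.range (p - 1),
      (g m : ZMod p) * ((m : ZMod p) + 1)⁻¹ := by
    rw [Int.cast_sum, Finset.mul_sum]
    refine Finset.sum_congr rfl fun m hm => ?_
    have h := congrArg (Nat.cast : ℕ → ZMod p) (hdiv m hm)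
    have hm1 := natCast_succ_ne_zero (p := p) (i := m) (by rw [Finset.mem_range] at hm; omega)
    rw [← h, Int.cast_mul, Int.cast_natCast, Nat.cast_mul, Nat.cast_succ]
    field_simp
  obtain ⟨c, hc⟩ : (p : ℤ) ∣ N - D * (-(legendreSym 3 p) * 2 * Q) := by
    rw [← ZMod.intCast_zmod_eq_zero_iff_dvd]
    push_cast
    rw [hNZ, key, sub_self]
  have hD0 : (D : ℚ) ≠ 0 := by exact_mod_cast (Nat.factorial_ne_zero _)
  rw [hS, hF, ratCongr]
  by_cases hc0 : c = 0
  · left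
    rw [hc0, mul_zero, sub_eq_zero] at hc
    have hc' := congrArg (Int.cast : ℤ → ℚ) hc
    rw [hNQ] at hc'
    push_cast at hc'
    exact mul_left_cancel₀ hD0 hc'
  · right
    have hc' := congrArg (Int.cast : ℤ → ℚ) hc
    push_cast at hc'
    rw [hNQ, ← mul_sub] at hc'
    have hcQ : (c : ℚ) ≠ 0 := by exact_mod_cast hc0
    rw [eq_div_of_mul_eq hD0 ((mul_comm _ _).trans hc'), padicValRat.div (mul_ne_zero hpQ hcQ) hD0,
      padicValRat.mul hpQ hcQ, padicValRat.self hp.one_lt, padicValRat.of_int, padicValRat.of_nat,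
      padicValNat.eq_zero_of_not_dvd hDp]
    simp
end

section
/- Let p > 3 be a prime. Then ∑_{k=1}^{p-1} k·g_k ≡ −3/4 (mod p²). -/
open Finset

theorem succ_mul_choose_succ_int (n k : ℕ) :
    ((k : ℤ) + 1) * (n.choose (k + 1) : ℤ) = ((n : ℤ) - k) * (n.choose k : ℤ) := by
  rcases le_or_gt k n with h | h
  · have := Nat.choose_succ_right_eq n k
    zify [h] at this
    linarith
  · simp [Nat.choose_eq_zero_of_lt h, Nat.choose_eq_zero_of_lt (h.trans (Nat.lt_succ_self k))]

theorem sub_mul_choose_succ_int {n k : ℕ} (h : k ≤ n + 1) :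
    ((n : ℤ) + 1 - k) * ((n + 1).choose k : ℤ) = ((n : ℤ) + 1) * (n.choose k : ℤ) := by
  have := Nat.choose_mul_succ_eq n k
  zify [h] at this
  linarith

/-- Recurrence in `k` for the sums `∑_{n<N} (n choose k)²`. -/
theorem sum_choose_sq_recurrence (N k : ℕ) :
    2 * (2 * (k : ℤ) + 3) * ∑ n ∈ range N, (n.choose (k + 1) : ℤ) ^ 2
      - ((k : ℤ) + 1) * ∑ n ∈ range N, (n.choose k : ℤ) ^ 2
      = (2 * (N : ℤ) - 3 * k - 3) * (N.choose (k + 1) : ℤ) ^ 2 := by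
  induction N with
  | zero => simp
  | succ N ih =>
    rw [sum_range_succ, sum_range_succ, Nat.choose_succ_succ]
    push_cast
    linear_combination ih +
      (4 * (N.choose (k + 1) : ℤ) + 2 * (N.choose k : ℤ)) * succ_mul_choose_succ_int N k

theorem sum_range_succ_choose_sq (k : ℕ) :
    ∑ a ∈ range (k + 1), (k.choose a : ℤ) ^ 2 = ((2 * k).choose k : ℤ) := by
  exact_mod_cast Nat.sum_range_choose_sq k

theorem two_mul_sum_mul_choose_sq (k : ℕ) :
    2 * ∑ a ∈ range (k + 1), (a : ℤ) * (k.choose a : ℤ) ^ 2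
      = (k : ℤ) * ((2 * k).choose k : ℤ) := by
  rw [two_mul]
  nth_rewrite 1 [← sum_range_reflect]
  rw [← sum_add_distrib, ← sum_range_succ_choose_sq, mul_sum]
  refine sum_congr rfl fun a ha => ?_
  have h : a ≤ k := Nat.lt_succ_iff.mp (mem_range.mp ha)
  rw [show k + 1 - 1 - a = k - a by omega, Nat.choose_symm h, Nat.cast_sub h]
  ring

/-- The squared trinomial coefficients summing to `g n` are symmetric in their three parts. -/
theorem sum_mul_choose_sq_symm (n : ℕ) :
    ∑ k ∈ range (n + 1), (k : ℤ) * ((n.choose k : ℤ) ^ 2 * ((2 * k).choose k : ℤ))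
      = 2 * ∑ k ∈ range (n + 1),
          ((n : ℤ) - k) * ((n.choose k : ℤ) ^ 2 * ((2 * k).choose k : ℤ)) := by
  have h1 : ∀ k ∈ range (n + 1),
      (k : ℤ) * ((n.choose k : ℤ) ^ 2 * ((2 * k).choose k : ℤ))
        = 2 * ∑ a ∈ range (n + 1), (a : ℤ) * ((n.choose k : ℤ) * (k.choose a : ℤ)) ^ 2 := by
    intro k hk
    have hs : range (k + 1) ⊆ range (n + 1) := by
      intro x hx
      simp only [mem_range] at *
      omega
    rw [← sum_subset hs]
    · calc _ = (n.choose k : ℤ) ^ 2 * ((k : ℤ) * ((2 * k).choose k : ℤ)) := by ring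
        _ = _ := by
          rw [← two_mul_sum_mul_choose_sq, mul_left_comm, mul_sum]
          congr 1
          exact sum_congr rfl fun a _ => by ring
    · intro x _ hx
      rw [Nat.choose_eq_zero_of_lt (show k < x by simpa using hx)]
      simp
  rw [sum_congr rfl h1, ← mul_sum, sum_comm]
  congr 1
  rw [← sum_range_reflect]
  refine sum_congr rfl fun j hj => ?_
  have hj' : j ≤ n := Nat.lt_succ_iff.mp (mem_range.mp hj)
  rw [show n + 1 - 1 - j = n - j by omega, ← sum_range_succ_choose_sq j, mul_sum, mul_sum,
    show n + 1 = (n - j) + (j + 1) by omega, sum_range_add]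
  rw [sum_eq_zero, zero_add]
  · refine sum_congr rfl fun i hi => ?_
    have hi' : i ≤ j := Nat.lt_succ_iff.mp (mem_range.mp hi)
    have h := Nat.choose_mul (n := n) (k := n - j + i) (s := n - j) (by omega)
    rw [Nat.choose_symm hj', show n - (n - j) = j by omega,
      show n - j + i - (n - j) = i by omega] at h
    rw [show (n.choose (n - j + i) : ℤ) * ((n - j + i).choose (n - j) : ℤ)
      = (n.choose j : ℤ) * (j.choose i : ℤ) by exact_mod_cast h, Nat.cast_sub hj']
    ring
  · intro x hx
    rw [Nat.choose_eq_zero_of_lt (mem_range.mp hx)]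
    simp

theorem sum_four_mul_add_three_mul_g (N : ℕ) :
    ∑ n ∈ range N, (4 * (n : ℤ) + 3) * g n
      = 3 * ∑ k ∈ range (N + 1), (((N : ℤ) - k) * (N.choose k : ℤ)) ^ 2 * (catalan k : ℤ) := by
  induction N with
  | zero => simp
  | succ N ih =>
    rw [sum_range_succ, ih, sum_range_succ _ (N + 1)]
    have h1 : ∀ k ∈ range (N + 1),
        ((((N + 1 : ℕ) : ℤ) - k) * ((N + 1).choose k : ℤ)) ^ 2 * (catalan k : ℤ)
          = (((N : ℤ) - k) * (N.choose k : ℤ)) ^ 2 * (catalan k : ℤ)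
            + (2 * (N : ℤ) + 1 - k) * ((N.choose k : ℤ) ^ 2 * ((2 * k).choose k : ℤ)) := by
      intro k hk
      have hc : ((k : ℤ) + 1) * (catalan k : ℤ) = ((2 * k).choose k : ℤ) := by
        exact_mod_cast succ_mul_catalan_eq_centralBinom k
      push_cast
      rw [sub_mul_choose_succ_int (by have := mem_range.mp hk; omega), ← hc]
      ring
    rw [sum_congr rfl h1, sum_add_distrib]
    have h2 := sum_mul_choose_sq_symm N
    have h3 : (4 * (N : ℤ) + 3) * g N - 3 * ∑ k ∈ range (N + 1),
        (2 * (N : ℤ) + 1 - k) * ((N.choose k : ℤ) ^ 2 * ((2 * k).choose k : ℤ)) =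
        ∑ k ∈ range (N + 1), (k : ℤ) * ((N.choose k : ℤ) ^ 2 * ((2 * k).choose k : ℤ))
        - 2 * ∑ k ∈ range (N + 1),
          ((N : ℤ) - k) * ((N.choose k : ℤ) ^ 2 * ((2 * k).choose k : ℤ)) := by
      rw [g, mul_sum, mul_sum, mul_sum, ← sum_sub_distrib, ← sum_sub_distrib]
      exact sum_congr rfl fun k _ => by ring
    simp only [sub_self, zero_mul, ne_eq, OfNat.ofNat_ne_zero, not_false_eq_true, zero_pow]
    linarith

theorem sq_dvd_sum_four_mul_add_three_mul_g {p : ℕ} (hp : p.Prime) :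
    (p : ℤ) ^ 2 ∣ ∑ n ∈ range p, (4 * (n : ℤ) + 3) * g n := by
  rw [sum_four_mul_add_three_mul_g]
  refine Dvd.dvd.mul_left (dvd_sum fun k hk => Dvd.dvd.mul_right (pow_dvd_pow_of_dvd ?_ 2) _) _
  obtain ⟨q, rfl⟩ : ∃ q, p = q + 1 := ⟨p - 1, by have := hp.pos; omega⟩
  push_cast
  rw [sub_mul_choose_succ_int (by have := mem_range.mp hk; omega)]
  exact dvd_mul_right _ _

/-- `(2k choose k) ∑_{n<p} (n choose k)²`, the `k`-th part of `∑_{n<p} g n`. -/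
def gPart (p k : ℕ) : ℤ :=
  ((2 * k).choose k : ℤ) * ∑ n ∈ range p, (n.choose k : ℤ) ^ 2

theorem sum_g_eq_sum_gPart (p : ℕ) : ∑ n ∈ range p, g n = ∑ k ∈ range p, gPart p k := by
  have h : ∀ n ∈ range p, g n = ∑ k ∈ range p, (n.choose k : ℤ) ^ 2 * ((2 * k).choose k : ℤ) := by
    intro n hn
    rw [g]
    refine sum_subset (fun x hx => ?_) fun x _ hx => ?_
    · simp only [mem_range] at *
      omega
    · rw [Nat.choose_eq_zero_of_lt (by simpa using hx)]
      simp
  rw [sum_congr rfl h, sum_comm]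
  refine sum_congr rfl fun k _ => ?_
  rw [gPart, mul_sum]
  exact sum_congr rfl fun n _ => by ring

theorem succ_mul_gPart_succ (p k : ℕ) :
    ((k : ℤ) + 1) * ((2 * ((k + 1 : ℕ) : ℤ) + 1) * gPart p (k + 1) - (2 * (k : ℤ) + 1) * gPart p k)
      = (2 * (k : ℤ) + 1) * ((2 * k).choose k : ℤ)
        * ((2 * (p : ℤ) - 3 * k - 3) * (p.choose (k + 1) : ℤ) ^ 2) := by
  have hc : ((k : ℤ) + 1) * ((2 * (k + 1)).choose (k + 1) : ℤ)
      = 2 * (2 * (k : ℤ) + 1) * ((2 * k).choose k : ℤ) := by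
    exact_mod_cast Nat.succ_mul_centralBinom_succ k
  rw [← sum_choose_sq_recurrence, gPart, gPart]
  push_cast
  linear_combination (2 * (k : ℤ) + 3) * (∑ n ∈ range p, (n.choose (k + 1) : ℤ) ^ 2) * hc

theorem Nat.Prime.isCoprime_pow_int {p : ℕ} (hp : p.Prime) {a : ℤ} (h : ¬ (p : ℤ) ∣ a) (m : ℕ) :
    IsCoprime ((p : ℤ) ^ m) a :=
  IsCoprime.pow_left (((Nat.prime_iff_prime_int.mp hp).coprime_iff_not_dvd).mpr h)

theorem not_dvd_succ {p k : ℕ} (hk : k + 1 < p) : ¬ (p : ℤ) ∣ (k : ℤ) + 1 := by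
  intro h
  have := Int.le_of_dvd (by positivity) h
  omega

theorem sq_dvd_gPart_succ_sub {p k : ℕ} (hp : p.Prime) (hk : k + 1 < p) :
    (p : ℤ) ^ 2 ∣ (2 * ((k + 1 : ℕ) : ℤ) + 1) * gPart p (k + 1) - (2 * (k : ℤ) + 1) * gPart p k := by
  refine (hp.isCoprime_pow_int (not_dvd_succ hk) 2).dvd_of_dvd_mul_left ?_
  rw [succ_mul_gPart_succ]
  refine Dvd.dvd.mul_left (Dvd.dvd.mul_left (pow_dvd_pow_of_dvd ?_ 2) _) _
  exact_mod_cast hp.dvd_choose_self (by omega) hk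

theorem dvd_two_mul_add_one_mul_choose {p k : ℕ} (hp : p.Prime) (hk : k < p) (h : p ≤ 2 * k + 1) :
    (p : ℤ) ∣ (2 * (k : ℤ) + 1) * ((2 * k).choose k : ℤ) := by
  rcases h.eq_or_lt with h | h
  · rw [h]
    push_cast
    exact dvd_mul_right _ _
  · refine Dvd.dvd.mul_left ?_ _
    exact_mod_cast hp.dvd_choose hk (by omega) (by omega)

theorem cube_dvd_gPart_succ_sub {p k : ℕ} (hp : p.Prime) (hk : k + 1 < p) (h : p ≤ 2 * k + 1) :
    (p : ℤ) ^ 3 ∣ (2 * ((k + 1 : ℕ) : ℤ) + 1) * gPart p (k + 1) - (2 * (k : ℤ) + 1) * gPart p k := by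
  refine (hp.isCoprime_pow_int (not_dvd_succ hk) 3).dvd_of_dvd_mul_left ?_
  rw [succ_mul_gPart_succ, pow_succ']
  refine mul_dvd_mul (dvd_two_mul_add_one_mul_choose hp (by omega) h)
    (Dvd.dvd.mul_left (pow_dvd_pow_of_dvd ?_ 2) _)
  exact_mod_cast hp.dvd_choose_self (by omega) hk

theorem sq_dvd_gPart_sub {p k : ℕ} (hp : p.Prime) (hk : k < p) :
    (p : ℤ) ^ 2 ∣ (2 * (k : ℤ) + 1) * gPart p k - p := by
  induction k with
  | zero => simp [gPart]
  | succ k ih =>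
    have := dvd_add (sq_dvd_gPart_succ_sub hp hk) (ih (by omega))
    rwa [sub_add_sub_cancel] at this

theorem sq_dvd_choose_two_mul_sub_two {p : ℕ} (hp : p.Prime) :
    (p : ℤ) ^ 2 ∣ ((2 * p).choose p : ℤ) - 2 := by
  rw [← sum_range_succ_choose_sq, sum_range_succ]
  obtain ⟨q, rfl⟩ : ∃ q, p = q + 1 := ⟨p - 1, by have := hp.pos; omega⟩
  rw [sum_range_succ']
  simp only [Nat.choose_zero_right, Nat.choose_self, Nat.cast_one, one_pow]
  rw [show ∀ x : ℤ, x + 1 + 1 - 2 = x by intro x; ring]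
  refine dvd_sum fun k hk => pow_dvd_pow_of_dvd ?_ 2
  exact_mod_cast hp.dvd_choose_self (by omega) (by have := mem_range.mp hk; omega)

/-- At `k = p - 1` the congruence is the weak form of Wolstenholme's theorem. -/
theorem cube_dvd_gPart_pred_sub {q : ℕ} (hp : (q + 1).Prime) (h2 : 2 < q + 1) :
    ((q + 1 : ℕ) : ℤ) ^ 3 ∣ (2 * (q : ℤ) + 1) * gPart (q + 1) q - (q + 1 : ℕ) := by
  have hs : ∑ n ∈ range (q + 1), (n.choose q : ℤ) ^ 2 = 1 := by
    rw [sum_range_succ, sum_eq_zero]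
    · simp
    · intro n hn
      rw [Nat.choose_eq_zero_of_lt (mem_range.mp hn)]
      simp
  have hc : ((q : ℤ) + 1) * ((2 * (q + 1)).choose (q + 1) : ℤ)
      = 2 * (2 * (q : ℤ) + 1) * ((2 * q).choose q : ℤ) := by
    exact_mod_cast Nat.succ_mul_centralBinom_succ q
  have h2' : ¬ ((q + 1 : ℕ) : ℤ) ∣ 2 := fun h => by
    have := Int.le_of_dvd (by norm_num) h
    omega
  refine (hp.isCoprime_pow_int h2' 3).dvd_of_dvd_mul_left ?_
  rw [gPart, hs, show (2 : ℤ) * ((2 * (q : ℤ) + 1) * (((2 * q).choose q : ℤ) * 1) - (q + 1 : ℕ))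
    = ((q + 1 : ℕ) : ℤ) * (((2 * (q + 1)).choose (q + 1) : ℤ) - 2) by
      push_cast; linear_combination -hc, pow_succ']
  exact mul_dvd_mul_left _ (sq_dvd_choose_two_mul_sub_two hp)

theorem cube_dvd_gPart_sub {q k : ℕ} (hp : (q + 1).Prime) (h2 : 2 < q + 1) (hk : k ≤ q)
    (h : q ≤ 2 * k) :
    ((q + 1 : ℕ) : ℤ) ^ 3 ∣ (2 * (k : ℤ) + 1) * gPart (q + 1) k - (q + 1 : ℕ) := by
  induction hk using Nat.decreasingInduction with
  | self => exact cube_dvd_gPart_pred_sub hp h2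
  | of_succ k hk ih =>
    have := dvd_sub (ih (by omega)) (cube_dvd_gPart_succ_sub hp (k := k) (by omega) (by omega))
    rwa [sub_sub_sub_cancel_left] at this

theorem sq_dvd_gPart_half_sub_one {m : ℕ} (hp : (2 * m + 1).Prime) :
    ((2 * m + 1 : ℕ) : ℤ) ^ 2 ∣ gPart (2 * m + 1) m - 1 := by
  have h := cube_dvd_gPart_sub (k := m) hp (by have := hp.two_le; omega) (by omega) le_rfl
  push_cast at h ⊢
  rw [pow_succ', ← mul_sub_one] at h
  exact (mul_dvd_mul_iff_left (by positivity)).mp h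

theorem sq_dvd_gPart_add_gPart_reflect {m k : ℕ} (hp : (2 * m + 1).Prime) (hk : k ≤ 2 * m)
    (hkm : k ≠ m) :
    ((2 * m + 1 : ℕ) : ℤ) ^ 2 ∣ gPart (2 * m + 1) k + gPart (2 * m + 1) (2 * m - k) := by
  have hnd : ∀ j : ℕ, j ≤ 2 * m → j ≠ m → ¬ ((2 * m + 1 : ℕ) : ℤ) ∣ 2 * (j : ℤ) + 1 := by
    rintro j hj hjm ⟨c, hc⟩
    push_cast at hc
    have h1 : 0 < c := by by_contra hc'; nlinarith
    have h2 : c < 2 := by by_contra hc'; nlinarith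
    have h3 : c = 1 := by omega
    subst h3
    omega
  have h1 := sq_dvd_gPart_sub (k := k) hp (by omega)
  have h2 := sq_dvd_gPart_sub (k := 2 * m - k) hp (by omega)
  have h3 : ((2 * m + 1 : ℕ) : ℤ) ∣ gPart (2 * m + 1) (2 * m - k) := by
    have hc := hp.isCoprime_pow_int (hnd (2 * m - k) (by omega) (by omega)) 1
    rw [pow_one] at hc
    refine hc.dvd_of_dvd_mul_left ?_
    exact (dvd_sub_left (dvd_refl _)).mp ((dvd_pow_self _ two_ne_zero).trans h2)
  refine (hp.isCoprime_pow_int (hnd k hk hkm) 2).dvd_of_dvd_mul_left ?_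
  have h3' := mul_dvd_mul_left ((2 * m + 1 : ℕ) : ℤ) h3
  rw [← sq] at h3'
  have h4 := dvd_add (dvd_sub h1 h2) (h3'.mul_left 2)
  convert h4 using 1
  push_cast [Nat.cast_sub hk]
  ring

theorem sq_dvd_sum_g_sub_one {p : ℕ} (hp : p.Prime) (h2 : 2 < p) :
    (p : ℤ) ^ 2 ∣ ∑ n ∈ range p, g n - 1 := by
  obtain ⟨m, rfl⟩ := hp.odd_of_ne_two (by omega)
  have h2' : ¬ ((2 * m + 1 : ℕ) : ℤ) ∣ 2 := fun h => by
    have := Int.le_of_dvd (by norm_num) h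
    omega
  refine (hp.isCoprime_pow_int h2' 2).dvd_of_dvd_mul_left ?_
  have h : 2 * (∑ n ∈ range (2 * m + 1), g n - 1) = ∑ k ∈ range (2 * m + 1),
      (gPart (2 * m + 1) k + gPart (2 * m + 1) (2 * m - k) - if k = m then 2 else 0) := by
    have hr := sum_range_reflect (gPart (2 * m + 1)) (2 * m + 1)
    rw [sum_sub_distrib, sum_add_distrib, sum_ite_eq', if_pos (mem_range.mpr (by omega)),
      sum_g_eq_sum_gPart]
    rw [show 2 * m + 1 - 1 = 2 * m by omega] at hr
    rw [hr]
    ring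
  rw [h]
  refine dvd_sum fun k hk => ?_
  split_ifs with hkm
  · subst hkm
    rw [show 2 * k - k = k by omega, show ∀ x : ℤ, x + x - 2 = 2 * (x - 1) by intro x; ring]
    exact (sq_dvd_gPart_half_sub_one hp).mul_left 2
  · rw [sub_zero]
    exact sq_dvd_gPart_add_gPart_reflect hp (by have := mem_range.mp hk; omega) hkm

theorem sq_dvd_four_mul_sum_mul_g_add_three {p : ℕ} (hp : p.Prime) (h2 : 2 < p) :
    (p : ℤ) ^ 2 ∣ 4 * ∑ k ∈ range p, (k : ℤ) * g k + 3 := by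
  have h := dvd_sub (sq_dvd_sum_four_mul_add_three_mul_g hp)
    ((sq_dvd_sum_g_sub_one hp h2).mul_left 3)
  simp only [add_mul, sum_add_distrib, mul_assoc, ← mul_sum] at h
  rwa [show ∀ x y : ℤ, 4 * x + 3 * y - 3 * (y - 1) = 4 * x + 3 by intro x y; ring] at h

theorem ratCongr_div_of_dvd {p m : ℕ} (hp : p.Prime) {a b c : ℤ} (hc : ¬ (p : ℤ) ∣ c)
    (h : (p : ℤ) ^ m ∣ c * a - b) : ratCongr p m (a : ℚ) ((b : ℚ) / c) := by
  have : Fact p.Prime := ⟨hp⟩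
  have hc0 : c ≠ 0 := fun h0 => hc (h0 ▸ dvd_zero _)
  have hcq : (c : ℚ) ≠ 0 := by exact_mod_cast hc0
  have heq : (a : ℚ) - b / c = ((c * a - b : ℤ) : ℚ) / (c : ℚ) := by
    push_cast
    field_simp
  by_cases h0 : c * a - b = 0
  · left
    rw [h0] at heq
    simpa [sub_eq_zero] using heq
  · right
    rw [heq, padicValRat.div (by exact_mod_cast h0) hcq, padicValRat.of_int, padicValRat.of_int,
      padicValInt.eq_zero_of_not_dvd hc]
    have := (padicValInt_dvd_iff m (c * a - b)).mp h
    simpa using this.resolve_left h0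

theorem sum_k_g (p : ℕ) (hp : p.Prime) (hp3 : 3 < p) :
    ratCongr p 2 (∑ k ∈ Finset.Icc 1 (p - 1), (k : ℚ) * (g k : ℚ)) (-3 / 4) := by
  have hs : ∑ k ∈ Finset.Icc 1 (p - 1), (k : ℚ) * (g k : ℚ)
      = ((∑ k ∈ range p, (k : ℤ) * g k : ℤ) : ℚ) := by
    push_cast
    refine sum_subset (fun k hk => ?_) fun k hk hk' => ?_
    · simp only [mem_Icc, mem_range] at *
      omega
    · simp only [mem_Icc, mem_range] at *
      rw [show k = 0 by omega]
      simp
  have h4 : ¬ (p : ℤ) ∣ 4 := by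
    intro h
    have h' : p ∣ 2 ^ 2 := by exact_mod_cast h
    have := Nat.le_of_dvd two_pos (hp.dvd_of_dvd_pow h')
    omega
  rw [hs]
  have h := ratCongr_div_of_dvd (b := -3) hp h4
    (by simpa using sq_dvd_four_mul_sum_mul_g_add_three hp (by omega))
  exact_mod_cast h
end

section
/- Let p > 3 be a prime. Then g_{p-1} ≡ (p/3)·(1 + 2p·q_p(3)) (mod p²). -/
open Finset Polynomial

lemma dvd_neg_one_pow_mul_choose_pred_sub_one {p : ℕ} (hp : p.Prime) {k : ℕ} (hk : k < p) :
    (p : ℤ) ∣ (-1) ^ k * ((p - 1).choose k : ℤ) - 1 := by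
  induction k with
  | zero => simp
  | succ k ih =>
    have h1 : (p : ℤ) ∣ (p.choose (k + 1) : ℤ) :=
      Int.natCast_dvd_natCast.2 (hp.dvd_choose_self k.succ_ne_zero hk)
    have h2 : (p.choose (k + 1) : ℤ) = (p - 1).choose k + (p - 1).choose (k + 1) := by
      obtain ⟨m, rfl⟩ : ∃ m, p = m + 1 := ⟨p - 1, by have := hp.pos; omega⟩
      simp [Nat.choose_succ_succ]
    have h3 : (-1) ^ (k + 1) * ((p - 1).choose (k + 1) : ℤ) - 1 =
        ((-1) ^ k * ((p - 1).choose k : ℤ) - 1) - (-1) ^ k * (p.choose (k + 1) : ℤ) := by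
      rw [h2]; ring
    rw [h3]
    exact dvd_sub (ih (by omega)) (h1.mul_left _)

lemma legendreSym_three_rec (m : ℕ) :
    legendreSym 3 ((m + 2 : ℕ) : ℤ) + legendreSym 3 ((m + 1 : ℕ) : ℤ) + legendreSym 3 m = 0 := by
  rw [legendreSym.mod 3 ((m + 2 : ℕ) : ℤ), legendreSym.mod 3 ((m + 1 : ℕ) : ℤ),
    legendreSym.mod 3 (m : ℤ)]
  have h : m % 3 = 0 ∨ m % 3 = 1 ∨ m % 3 = 2 := by omega
  rcases h with h | h | h
  · rw [show ((m + 2 : ℕ) : ℤ) % (3 : ℕ) = 2 by omega,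
      show ((m + 1 : ℕ) : ℤ) % (3 : ℕ) = 1 by omega,
      show (m : ℤ) % (3 : ℕ) = 0 by omega]; decide
  · rw [show ((m + 2 : ℕ) : ℤ) % (3 : ℕ) = 0 by omega,
      show ((m + 1 : ℕ) : ℤ) % (3 : ℕ) = 2 by omega,
      show (m : ℤ) % (3 : ℕ) = 1 by omega]; decide
  · rw [show ((m + 2 : ℕ) : ℤ) % (3 : ℕ) = 1 by omega,
      show ((m + 1 : ℕ) : ℤ) % (3 : ℕ) = 0 by omega,
      show (m : ℤ) % (3 : ℕ) = 2 by omega]; decide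

/-- The power series inverse of `1 + X + X ^ 2` has the character modulo `3` as coefficients. -/
lemma one_add_X_add_X_sq_mul_mk_legendreSym :
    (1 + PowerSeries.X + PowerSeries.X ^ 2 : PowerSeries ℤ) *
      PowerSeries.mk (fun j ↦ legendreSym 3 ((j + 1 : ℕ) : ℤ)) = 1 := by
  ext n
  rw [add_mul, add_mul, one_mul]
  rcases n with _ | _ | n
  · simp
  · have := legendreSym_three_rec 0
    simp [pow_two, mul_assoc, PowerSeries.coeff_succ_X_mul] at this ⊢
    simpa [PowerSeries.coeff_one] using this
  · have := legendreSym_three_rec (n + 1)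
    simp only [pow_two, mul_assoc, map_add, PowerSeries.coeff_succ_X_mul, PowerSeries.coeff_mk,
      PowerSeries.coeff_one]
    rw [if_neg (by omega)]
    exact this

/-- The Sun–Tauraso identity for the partial sums of the central binomial coefficients. -/
lemma sum_centralBinom_eq (n : ℕ) :
    ∑ k ∈ range n, ((2 * k).choose k : ℤ) =
      ∑ k ∈ range n, ((2 * n).choose k : ℤ) * legendreSym 3 ((n - k : ℕ) : ℤ) := by
  rcases n with _ | n
  · simp
  set U : PowerSeries ℤ := PowerSeries.mk (fun j ↦ legendreSym 3 ((j + 1 : ℕ) : ℤ)) with hU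
  set Q : ℤ[X] := ∑ k ∈ range (n + 1), ((1 + X) ^ 2) ^ k * X ^ (n + 1 - 1 - k) with hQ
  have h1 : Q * (1 + X + X ^ 2) = (1 + X) ^ (2 * (n + 1)) - X ^ (n + 1) := by
    rw [pow_mul, ← (Commute.all ((1 + X : ℤ[X]) ^ 2) X).geom_sum₂_mul]
    congr 1; ring
  have h2 : (Q : PowerSeries ℤ) = (((1 + X : ℤ[X]) ^ (2 * (n + 1)) - X ^ (n + 1) : ℤ[X]) :
      PowerSeries ℤ) * U := by
    rw [← h1, Polynomial.coe_mul, mul_assoc]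
    have := one_add_X_add_X_sq_mul_mk_legendreSym
    simp only [Polynomial.coe_add, Polynomial.coe_one, Polynomial.coe_X, Polynomial.coe_pow]
    rw [this, mul_one]
  have h3 : Q.coeff n = ∑ k ∈ range (n + 1), ((2 * k).choose k : ℤ) := by
    rw [hQ, finsetSum_coeff]
    refine sum_congr rfl fun k hk ↦ ?_
    have hk : k ≤ n := by simpa [Nat.lt_succ_iff] using hk
    rw [← pow_mul, coeff_mul_X_pow', if_pos (by omega), coeff_one_add_X_pow]
    congr 2; omega
  rw [← h3, ← Polynomial.coeff_coe, h2, PowerSeries.coeff_mul,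
    Nat.sum_antidiagonal_eq_sum_range_succ_mk]
  refine sum_congr rfl fun k hk ↦ ?_
  have hk : k ≤ n := by simpa [Nat.lt_succ_iff] using hk
  rw [Polynomial.coeff_coe, coeff_sub, coeff_one_add_X_pow, coeff_X_pow, if_neg (by omega),
    sub_zero, hU, PowerSeries.coeff_mk]
  congr 3; omega

section
variable {A : Type*} [CommRing A]

lemma choose_two_mul_eq {p : ℕ} (hp : p.Prime) (hA : (p : A) ^ 2 = 0) {k : ℕ} (hk : k < p) :
    ((2 * p).choose k : A) = 2 * p.choose k - if k = 0 then 1 else 0 := by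
  rcases k with _ | k
  · norm_num
  rw [two_mul p, Nat.add_choose_eq, Nat.sum_antidiagonal_eq_sum_range_succ_mk, sum_range_succ,
    sum_range_succ']
  push_cast
  rw [sum_eq_zero]
  · simp; ring
  intro i hi
  have hi : i < k := by simpa using hi
  obtain ⟨a, ha⟩ := hp.dvd_choose_self i.succ_ne_zero (by omega)
  obtain ⟨b, hb⟩ := hp.dvd_choose_self (k := k - i) (by omega) (by omega)
  rw [ha, hb]
  push_cast
  linear_combination (a * b : A) * hA

lemma sub_mul_legendreSym_three {w v : A} (h1 : w + v = -1) (h2 : w * v = 1) (k : ℕ) :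
    (w - v) * (legendreSym 3 k : A) = w ^ k - v ^ k := by
  induction k using Nat.twoStepInduction with
  | zero => simp
  | one => simp
  | more k ih1 ih2 =>
    have h := congrArg (Int.cast : ℤ → A) (legendreSym_three_rec k)
    push_cast at h ih1 ih2 ⊢
    have hw : w ^ 2 + w + 1 = 0 := by linear_combination w * h1 - h2
    have hv : v ^ 2 + v + 1 = 0 := by linear_combination v * h1 - h2
    linear_combination (w - v) * h - ih1 - ih2 - w ^ k * hw + v ^ k * hv

/-- Both sides are the coefficient of `X ^ n` in `(-(1 + X + X ^ 2)) ^ n`, where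
`1 + X + X ^ 2 = (X - w) * (X - v)`. -/
lemma sum_neg_one_pow_mul_choose_mul_centralBinom {w v : A} (h1 : w + v = -1) (h2 : w * v = 1)
    (n : ℕ) :
    ∑ k ∈ range (n + 1), (-1) ^ k * (n.choose k : A) * ((2 * k).choose k : A) =
      ∑ k ∈ range (n + 1), (n.choose k : A) ^ 2 * (w ^ k * v ^ (n - k)) := by
  have h : (-(1 + X) ^ 2 + X) ^ n =
      (-1) ^ n * ((X + C (-v)) ^ n * (X + C (-w)) ^ n : A[X]) := by
    rw [← mul_pow, ← mul_pow]
    congr 1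
    have e1 : C w + C v = (-1 : A[X]) := by rw [← C_add, h1]; simp
    have e2 : C w * C v = (1 : A[X]) := by rw [← C_mul, h2]; simp
    simp only [C_neg]
    linear_combination e2 - X * e1
  have h3 := congrArg (fun P ↦ P.coeff n) h
  rw [add_pow] at h3
  simp only [finsetSum_coeff] at h3
  have e : ((-1) ^ n : A[X]) = C ((-1) ^ n) := by simp
  rw [e, coeff_C_mul, coeff_mul, Nat.sum_antidiagonal_eq_sum_range_succ_mk] at h3
  refine Eq.trans (sum_congr rfl fun k hk ↦ ?_) (h3.trans ?_)
  · have hk : k ≤ n := by simpa [Nat.lt_succ_iff] using hk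
    have e' : ((-(1 + X) ^ 2) ^ k * X ^ (n - k) * (n.choose k : A[X]) : A[X]) =
      C ((-1) ^ k * (n.choose k : A)) * ((1 + X) ^ (2 * k) * X ^ (n - k)) := by
      rw [neg_pow, ← pow_mul]; simp; ring
    rw [e', coeff_C_mul, coeff_mul_X_pow', if_pos (by omega), coeff_one_add_X_pow,
      show n - (n - k) = k by omega]
  · rw [mul_sum]
    refine sum_congr rfl fun k hk ↦ ?_
    have hk : k ≤ n := by simpa [Nat.lt_succ_iff] using hk
    rw [coeff_X_add_C_pow, coeff_X_add_C_pow, show n - (n - k) = k by omega, Nat.choose_symm hk,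
      neg_pow v, neg_pow w]
    have h4 : (-1 : A) ^ n = (-1) ^ (n - k) * (-1) ^ k := by rw [← pow_add]; congr 1; omega
    have h5 : (-1 : A) ^ n * (-1) ^ n = 1 := by rw [← mul_pow]; simp
    rw [h4] at h5 ⊢
    linear_combination (n.choose k : A) ^ 2 * (w ^ k * v ^ (n - k)) * h5

lemma choose_pred_sq {p : ℕ} (hp : p.Prime) (hA : (p : A) ^ 2 = 0) {k : ℕ} (hk : k < p) :
    ((p - 1).choose k : A) ^ 2 = 2 * ((-1) ^ k * ((p - 1).choose k : A)) - 1 := by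
  obtain ⟨c, hc⟩ := dvd_neg_one_pow_mul_choose_pred_sub_one hp hk
  have h := congrArg (Int.cast : ℤ → A) hc
  push_cast at h
  have h1 : ((-1 : A) ^ k) ^ 2 = 1 := by rw [← pow_mul, mul_comm, pow_mul]; simp
  linear_combination (c : A) ^ 2 * hA - ((p - 1).choose k : A) ^ 2 * h1 +
    ((-1) ^ k * ((p - 1).choose k : A) - 1 + p * c) * h

lemma isUnit_sub_of_add_eq_neg_one_of_mul_eq_one {w v : A} (h1 : w + v = -1)
    (h2 : w * v = 1) (h3 : IsUnit (3 : A)) :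
    IsUnit (w - v) := by
  have h : (w - v) ^ 2 = -3 := by linear_combination (w + v - 1) * h1 - 4 * h2
  exact (isUnit_pow_iff two_ne_zero).1 (h ▸ h3.neg)

lemma sum_choose_mul_legendreSym_three {w v : A} (h1 : w + v = -1) (h2 : w * v = 1)
    (h3 : IsUnit (3 : A)) {n : ℕ} (hn : Odd n) :
    ∑ k ∈ range (n + 1), (n.choose k : A) * (legendreSym 3 k : A) = (legendreSym 3 n : A) := by
  apply (isUnit_sub_of_add_eq_neg_one_of_mul_eq_one h1 h2 h3).mul_left_cancel
  have hw : (w + 1) ^ n = -v ^ n := by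
    rw [show w + 1 = -v by linear_combination h1, hn.neg_pow]
  have hv : (v + 1) ^ n = -w ^ n := by
    rw [show v + 1 = -w by linear_combination h1, hn.neg_pow]
  rw [sub_mul_legendreSym_three h1 h2, mul_sum]
  calc _ = (w + 1) ^ n - (v + 1) ^ n := by
        rw [add_pow, add_pow, ← sum_sub_distrib]
        refine sum_congr rfl fun k _ ↦ ?_
        rw [mul_left_comm, sub_mul_legendreSym_three h1 h2]
        simp; ring
    _ = _ := by rw [hw, hv]; ring

/-- The sum `∑_{k < p} (2k choose k)` is congruent to `(p / 3)` modulo `p ^ 2`. -/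
lemma sum_centralBinom_eq_legendreSym_three {w v : A} (h1 : w + v = -1) (h2 : w * v = 1)
    (h3 : IsUnit (3 : A)) {p : ℕ} (hp : p.Prime) (hp2 : Odd p) (hA : (p : A) ^ 2 = 0) :
    ∑ k ∈ range p, ((2 * k).choose k : A) = (legendreSym 3 p : A) := by
  have h := congrArg (Int.cast : ℤ → A) (sum_centralBinom_eq p)
  push_cast at h
  have h4 : ∑ k ∈ range p, (p.choose k : A) * (legendreSym 3 ((p - k : ℕ) : ℤ) : A) =
      (legendreSym 3 p : A) := by
    rw [← sum_choose_mul_legendreSym_three h1 h2 h3 hp2, ← sum_range_reflect _ (p + 1), sum_range_succ]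
    simp only [add_tsub_cancel_right, tsub_self, Nat.cast_zero, legendreSym.at_zero, Int.cast_zero,
      mul_zero, add_zero]
    refine sum_congr rfl fun k hk ↦ ?_
    rw [Nat.choose_symm (mem_range.1 hk).le]
  have h5 : ∑ k ∈ range p,
      (if k = 0 then (1 : A) else 0) * (legendreSym 3 ((p - k : ℕ) : ℤ) : A) =
      (legendreSym 3 p : A) := by
    rw [sum_eq_single_of_mem 0 (mem_range.2 hp.pos)]
    · simp
    · intro k _ hk; simp [hk]
  rw [h]
  calc _ = ∑ k ∈ range p, (2 * ((p.choose k : A) * (legendreSym 3 ((p - k : ℕ) : ℤ) : A)) -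
        (if k = 0 then (1 : A) else 0) * (legendreSym 3 ((p - k : ℕ) : ℤ) : A)) := by
        refine sum_congr rfl fun k hk ↦ ?_
        rw [choose_two_mul_eq hp hA (mem_range.1 hk)]; ring
    _ = _ := by rw [sum_sub_distrib, ← mul_sum, h4, h5]; ring

lemma sum_choose_pred_sq_mul {w v : A} (h1 : w + v = -1) (h2 : w * v = 1)
    (h3 : IsUnit (3 : A)) {p : ℕ} (hp : p.Prime) (hp2 : Odd p) (hA : (p : A) ^ 2 = 0) :
    ∑ k ∈ range p, ((p - 1).choose k : A) ^ 2 * (w ^ k * v ^ (p - 1 - k)) =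
      2 * (-3) ^ (p / 2) - (legendreSym 3 p : A) := by
  have h4 : ∑ k ∈ range p, w ^ k * v ^ (p - 1 - k) = (legendreSym 3 p : A) := by
    apply (isUnit_sub_of_add_eq_neg_one_of_mul_eq_one h1 h2 h3).mul_left_cancel
    rw [sub_mul_legendreSym_three h1 h2, mul_comm, geom_sum₂_mul]
  have h5 : ∑ k ∈ range p, (-w) ^ k * v ^ (p - 1 - k) * ((p - 1).choose k : A) =
      (-3) ^ (p / 2) := by
    have h := add_pow (-w) v (p - 1)
    rw [Nat.sub_add_cancel hp.one_le] at h
    obtain ⟨m, rfl⟩ := hp2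
    rw [← h, show 2 * m + 1 - 1 = 2 * m by omega, show (2 * m + 1) / 2 = m by omega, pow_mul]
    congr 1
    linear_combination (w + v - 1) * h1 - 4 * h2
  rw [← h4, ← h5, mul_sum, ← sum_sub_distrib]
  refine sum_congr rfl fun k hk ↦ ?_
  rw [choose_pred_sq hp hA (mem_range.1 hk), neg_pow w]
  ring

lemma cast_g_pred {w v : A} (h1 : w + v = -1) (h2 : w * v = 1)
    (h3 : IsUnit (3 : A)) {p : ℕ} (hp : p.Prime) (hp2 : Odd p) (hA : (p : A) ^ 2 = 0) :
    (g (p - 1) : A) = 4 * (-3) ^ (p / 2) - 3 * (legendreSym 3 p : A) := by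
  have h := sum_neg_one_pow_mul_choose_mul_centralBinom h1 h2 (p - 1)
  rw [Nat.sub_add_cancel hp.one_le, sum_choose_pred_sq_mul h1 h2 h3 hp hp2 hA] at h
  have h4 := sum_centralBinom_eq_legendreSym_three h1 h2 h3 hp hp2 hA
  rw [g, Nat.sub_add_cancel hp.one_le]
  push_cast
  calc _ = ∑ k ∈ range p, (2 * ((-1) ^ k * ((p - 1).choose k : A) * ((2 * k).choose k : A)) -
        ((2 * k).choose k : A)) := by
        refine sum_congr rfl fun k hk ↦ ?_
        rw [choose_pred_sq hp hA (mem_range.1 hk)]; ring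
    _ = _ := by rw [sum_sub_distrib, ← mul_sum, h, h4]; ring

end

lemma legendreSym_neg_three {p : ℕ} [Fact p.Prime] (hp2 : p ≠ 2) :
    legendreSym p (-3) = legendreSym 3 p := by
  have h := legendreSym.quadratic_reciprocity' (p := p) (q := 3) hp2 (by norm_num)
  rw [show (-3 : ℤ) = -1 * (3 : ℕ) by norm_num, legendreSym.mul, h,
    legendreSym.at_neg_one hp2,
    ZMod.χ₄_eq_neg_one_pow (Fact.out (p := p.Prime) |>.mod_two_eq_one_iff_ne_two.2 hp2)]
  norm_num

lemma dvd_g_pred_sub {p : ℕ} (hp : p.Prime) (hp3 : 3 < p) :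
    (p : ℤ) ^ 2 ∣ g (p - 1) - (4 * (-3) ^ (p / 2) - 3 * legendreSym 3 p) := by
  have key := cast_g_pred (A := QuadraticAlgebra (ZMod (p ^ 2)) (-1) (-1)) (w := ⟨0, 1⟩)
    (v := ⟨-1, -1⟩) (by ext <;> simp [QuadraticAlgebra.re_one, QuadraticAlgebra.im_one])
    (by ext <;> simp [QuadraticAlgebra.re_one, QuadraticAlgebra.im_one]) ?_ hp
    (hp.odd_of_ne_two (by omega)) ?_
  · have h : ((g (p - 1) : ℤ) : QuadraticAlgebra (ZMod (p ^ 2)) (-1) (-1)) =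
        ((4 * (-3) ^ (p / 2) - 3 * legendreSym 3 p : ℤ) :) := by
      rw [key]; push_cast; rfl
    have h' := congrArg QuadraticAlgebra.re h
    rw [QuadraticAlgebra.re_intCast, QuadraticAlgebra.re_intCast] at h'
    exact_mod_cast (ZMod.intCast_eq_intCast_iff_dvd_sub _ _ _).1 h'.symm
  · have : IsUnit ((3 : ℕ) : ZMod (p ^ 2)) := by
      rw [ZMod.isUnit_iff_coprime]
      exact ((Nat.coprime_primes Nat.prime_three hp).2 (by omega)).pow_right 2
    have h := this.map (algebraMap _ (QuadraticAlgebra (ZMod (p ^ 2)) (-1) (-1)))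
    rw [map_natCast] at h
    exact_mod_cast h
  · have : ((p : ZMod (p ^ 2))) ^ 2 = 0 := by exact_mod_cast ZMod.natCast_self (p ^ 2)
    simpa using congrArg (algebraMap _ (QuadraticAlgebra (ZMod (p ^ 2)) (-1) (-1))) this

theorem g_pred_congr (p : ℕ) (hp : p.Prime) (hp3 : 3 < p) :
    (p : ℤ) ^ 2 ∣ g (p - 1)
      - legendreSym 3 p * (1 + 2 * (p : ℤ) * ((3 ^ (p - 1) - 1) / (p : ℤ))) := by
  have := Fact.mk hp
  have hodd : Odd p := hp.odd_of_ne_two (by omega)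
  have h3 : ((3 : ℤ) : ZMod p) ≠ 0 := by
    rw [Ne, ZMod.intCast_zmod_eq_zero_iff_dvd]
    exact_mod_cast fun h ↦ absurd (Nat.le_of_dvd (by norm_num) h) (by omega)
  have hq : (p : ℤ) ∣ 3 ^ (p - 1) - 1 := by
    rw [← ZMod.intCast_zmod_eq_zero_iff_dvd]
    push_cast at h3 ⊢
    rw [ZMod.pow_card_sub_one_eq_one h3, sub_self]
  have hs : (p : ℤ) ∣ (-3) ^ (p / 2) - legendreSym 3 p := by
    rw [← ZMod.intCast_zmod_eq_zero_iff_dvd, ← legendreSym_neg_three (p := p) (by omega)]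
    push_cast
    rw [legendreSym.eq_pow]
    simp
  have hsq : ((-3 : ℤ) ^ (p / 2)) ^ 2 = 3 ^ (p - 1) := by
    obtain ⟨m, rfl⟩ := hodd
    rw [show 2 * m + 1 - 1 = 2 * m by omega, show (2 * m + 1) / 2 = m by omega, ← pow_mul, mul_comm,
      pow_mul, pow_mul]
    norm_num
  have hε : legendreSym 3 p ^ 2 = 1 := by
    apply legendreSym.sq_one
    rw [Ne, ZMod.intCast_zmod_eq_zero_iff_dvd]
    exact_mod_cast fun h ↦ absurd ((Nat.prime_dvd_prime_iff_eq Nat.prime_three hp).1 h) (by omega)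
  rw [mul_assoc 2 (p : ℤ), Int.mul_ediv_cancel' hq]
  obtain ⟨a, ha⟩ := dvd_g_pred_sub hp hp3
  obtain ⟨b, hb⟩ := hs
  refine ⟨a - 2 * legendreSym 3 p * b ^ 2, ?_⟩
  set s : ℤ := (-3) ^ (p / 2)
  set ε := legendreSym 3 p
  linear_combination ha + 2 * ε * hsq - 2 * ε * (s - ε + p * b) * hb + (2 * ε - 4 * s) * hε
end
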